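/- arXiv:1810.12480 — 2 statements merged into one kernel-verified Lean document; each statement's English description precedes it below -/
import Mathlib

section
/- Let i = (i_1,…,i_N) be a reduced word for w_0, λ a dominant integral weight, and for 1 ≤ k ≤ N set w_{≥k} = s_{i_k}⋯s_{i_N}, x_k = −⟨w_{≥k}λ, h_{i_k}⟩, and x_{≥k} = π_{≥k}(b_{w_{≥k}λ}). Then for 2 ≤ k ≤ N: ε_{i_{k-1}}(x_{≥k-1}) = x_{k-1}; ẽ_{i_{k-1}}^{x_{k-1}} x_{≥k-1} = (0)_{i_{k-1}} ⊗ x_{≥k}; φ_{i_{k-1}}((0)_{i_{k-1}} ⊗ x_{≥k}) = x_{k-1}; and f̃_{i_{k-1}}^{x_{k-1}}((0)_{i_{k-1}} ⊗ x_{≥k}) = x_{≥k-1}. -/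
open scoped BigOperators Pointwise Classical

noncomputable section

namespace NZ

/-! ## Conventions

`n` is the rank of the complex semisimple Lie algebra `g`, with index set `I = Fin n`.
An integral weight `λ` is recorded by its coordinates in the fundamental-weight basis,
i.e. by the function `(fun i => ⟨λ, h_i⟩) : Fin n → ℤ`; `λ` is dominant iff `0 ≤ λ`.
The Cartan matrix entry `C i j` is `⟨α_j, h_i⟩`.
`N` is the length of the longest element `w₀` of the Weyl group, and a reduced word for `w₀`
is recorded as `w : Fin N → Fin n` (`w k` is the letter `i_{k+1}` of the paper's 1-based word
`(i_1, …, i_N)`). -/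

abbrev Pt (N : ℕ) := Fin N → ℝ

def toR {m : ℕ} (a : Fin m → ℤ) : Fin m → ℝ := fun k => (a k : ℝ)

/-- axioms for a Cartan matrix of a semisimple Lie algebra (finiteness of the Weyl group is
imposed separately, through the existence of a longest element). -/
structure IsCartanMatrix {n : ℕ} (C : Fin n → Fin n → ℤ) : Prop where
  diag : ∀ i, C i i = 2
  off_diag : ∀ i j, i ≠ j → C i j ≤ 0
  zero_iff : ∀ i j, C i j = 0 ↔ C j i = 0

/-- the simple reflection `s_i` acting on the weight lattice (`⟨α_j, h_i⟩ = C i j`). -/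
def simpleRefl {n : ℕ} (C : Fin n → Fin n → ℤ) (i : Fin n) (lam : Fin n → ℤ) : Fin n → ℤ :=
  fun j => lam j - lam i * C j i

/-- the action of the word `ω = (i_1, …, i_r)`, i.e. of `s_{i_1} ⋯ s_{i_r}`,
on the weight lattice. -/
def wordAction {n : ℕ} (C : Fin n → Fin n → ℤ) : List (Fin n) → (Fin n → ℤ) → (Fin n → ℤ)
  | [] => id
  | i :: ω => fun lam => simpleRefl C i (wordAction C ω lam)

/-- `ω` is a reduced word for the longest element `w₀` of the Weyl group:
no strictly shorter word represents the same Weyl group element, and every Weyl group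
element is represented by a word of length at most `ω.length`. -/
def IsReducedWordForLongest {n : ℕ} (C : Fin n → Fin n → ℤ) (ω : List (Fin n)) : Prop :=
  (∀ ω' : List (Fin n), wordAction C ω' = wordAction C ω → ω.length ≤ ω'.length) ∧
  ∀ ω' : List (Fin n), ∃ ω'' : List (Fin n),
      ω''.length ≤ ω.length ∧ wordAction C ω'' = wordAction C ω'

/-- `x_k := -⟨w_{≥k} λ, h_{i_k}⟩` where `w_{≥k} = s_{i_k} ⋯ s_{i_N}`
(`k : Fin N` is `0`-based, corresponding to the paper's `k+1`). -/
def xCoord {n N : ℕ} (C : Fin n → Fin n → ℤ) (w : Fin N → Fin n) (lam : Fin n → ℤ)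
    (k : Fin N) : ℤ :=
  - wordAction C ((List.ofFn w).drop k) lam (w k)

/-- `d_i` : the number of occurrences of the letter `i` in the word `w`. -/
def dcount {n N : ℕ} (w : Fin N → Fin n) (i : Fin n) : ℕ :=
  (Finset.univ.filter fun k => w k = i).card

/-! ## Polytopes, parapolytopes and convex-geometric Demazure operators -/

def IsConvexPolytope {N : ℕ} (P : Set (Pt N)) : Prop :=
  ∃ V : Finset (Pt N), P = convexHull ℝ (V : Set (Pt N))

def IsLatticePolytope {N : ℕ} (P : Set (Pt N)) : Prop :=
  ∃ V : Finset (Fin N → ℤ), P = convexHull ℝ (toR '' (V : Set (Fin N → ℤ)))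

/-- the slice `c + ℝ^{d_i}` : all points agreeing with `c` on every coordinate whose
letter is different from `i`. -/
def slice {n N : ℕ} (w : Fin N → Fin n) (i : Fin n) (c : Pt N) : Set (Pt N) :=
  {y | ∀ k, w k ≠ i → y k = c k}

/-- the coordinate parallelepiped `c + Π(μ, ν)` inside the slice `c + ℝ^{d_i}`. -/
def box {n N : ℕ} (w : Fin N → Fin n) (i : Fin n) (c : Pt N) (μ ν : Fin N → ℝ) :
    Set (Pt N) :=
  {y | (∀ k, w k ≠ i → y k = c k) ∧ ∀ k, w k = i → y k ∈ Set.Icc (μ k) (ν k)}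

/-- integral version of `slice`. -/
def zslice {n N : ℕ} (w : Fin N → Fin n) (i : Fin n) (c : Fin N → ℤ) : Set (Fin N → ℤ) :=
  {y | ∀ k, w k ≠ i → y k = c k}

/-- integral version of `box` : `c + Π_ℤ(μ, ν)`. -/
def zbox {n N : ℕ} (w : Fin N → Fin n) (i : Fin n) (c μ ν : Fin N → ℤ) : Set (Fin N → ℤ) :=
  {y | (∀ k, w k ≠ i → y k = c k) ∧ ∀ k, w k = i → y k ∈ Set.Icc (μ k) (ν k)}

/-- Kiritchenko's parapolytopes: every slice in an `ℝ^{d_i}`-direction is a coordinate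
parallelepiped. -/
def IsParapolytope {n N : ℕ} (w : Fin N → Fin n) (P : Set (Pt N)) : Prop :=
  IsConvexPolytope P ∧
  ∀ (i : Fin n) (c : Pt N), ∃ μ ν : Fin N → ℝ, P ∩ slice w i c = box w i c μ ν

/-- the linear function `l_i(a) = -∑_{j ≠ i} c_{i j} (a_1^{(j)} + ⋯ + a_{d_j}^{(j)})`. -/
def lfun {n N : ℕ} (C : Fin n → Fin n → ℤ) (w : Fin N → Fin n) (i : Fin n) (x : Pt N) : ℝ :=
  -∑ k ∈ Finset.univ.filter (fun k => w k ≠ i), (C i (w k) : ℝ) * x k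

/-- the value at `x` of the function `D_{i}^{(k)}(P)` (with `i = w k`), the
convex-geometric Demazure operator of Kiritchenko applied to `P`, defined slice-wise:
on a slice `c + Π(μ,ν)` one replaces `ν_{m_k}` by
`ν'_{m_k} = ν_{m_k} + l_i(c) - ∑_l (μ_l + ν_l)` if `ν'_{m_k} ≥ ν_{m_k}`, and otherwise the
value is that of `-𝟙_{c + Π(μ',ν)} + 𝟙_P + 𝟙_{P'}` where `μ'` replaces `μ_{m_k}` by
`ν'_{m_k}` and `P'` is the facet of `c + Π(μ',ν)` parallel to `P`. -/
def demazureValue {n N : ℕ} (C : Fin n → Fin n → ℤ) (w : Fin N → Fin n) (k : Fin N)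
    (P : Set (Pt N)) (x : Pt N) : ℝ :=
  if h : ∃ μ ν : Fin N → ℝ,
      (P ∩ slice w (w k) x).Nonempty ∧ P ∩ slice w (w k) x = box w (w k) x μ ν then
    let μ := h.choose
    let ν := h.choose_spec.choose
    let ν' : ℝ := ν k + lfun C w (w k) x
        - ∑ l ∈ Finset.univ.filter (fun l => w l = w k), (μ l + ν l)
    if ν k ≤ ν' then
      (if x ∈ box w (w k) x μ (Function.update ν k ν') then (1 : ℝ) else 0)
    else
      (if x ∈ box w (w k) x (Function.update μ k ν') ν then (-1 : ℝ) else 0)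
      + (if x ∈ box w (w k) x μ ν then (1 : ℝ) else 0)
      + (if x ∈ box w (w k) x (Function.update μ k ν') (Function.update ν k ν')
          then (1 : ℝ) else 0)
  else 0

/-- `DemazureChain C w l P Q` : the composite `D_{i_l}^{(l)} ⋯ D_{i_1}^{(1)}(P)` is
well-defined with value the convex polytope `Q`; i.e. at each step the input is a
parapolytope on which the relevant coordinate is constant, and the output is the
characteristic function of a convex polytope. -/
inductive DemazureChain {n N : ℕ} (C : Fin n → Fin n → ℤ) (w : Fin N → Fin n) :
    ℕ → Set (Pt N) → Set (Pt N) → Prop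
  | zero (P : Set (Pt N)) : DemazureChain C w 0 P P
  | succ (l : ℕ) (hl : l < N) (P Q R : Set (Pt N)) :
      DemazureChain C w l P Q →
      IsParapolytope w Q →
      (∀ x ∈ Q, ∀ y ∈ Q, x ⟨l, hl⟩ = y ⟨l, hl⟩) →
      IsConvexPolytope R →
      (∀ x, demazureValue C w ⟨l, hl⟩ Q x = if x ∈ R then 1 else 0) →
      DemazureChain C w (l + 1) P R

/-! ## The Nakashima–Zelevinsky polytope -/

/-- the smallest closed convex cone containing `S`. -/
def smallestClosedCone {E : Type*} [AddCommMonoid E] [Module ℝ E] [TopologicalSpace E]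
    (S : Set E) : Set E :=
  ⋂₀ {T : Set E | S ⊆ T ∧ IsClosed T ∧ Convex ℝ T ∧ ∀ c : ℝ, 0 ≤ c → ∀ x ∈ T, c • x ∈ T}

/-- the cone `C_i(λ)` : the smallest closed cone containing
`S_i(λ) = ⋃_{k>0} {(k, Ψ_i(b)) | b ∈ B(kλ)}`, defined from the family
`B = (Ψ_i(B(μ)))_μ` of images of the crystal bases under the Kashiwara embedding. -/
def NZcone {n N : ℕ} (B : (Fin n → ℤ) → Set (Fin N → ℤ)) (lam : Fin n → ℤ) :
    Set (ℝ × Pt N) :=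
  smallestClosedCone
    {p | ∃ (k : ℕ) (b : Fin N → ℤ), 0 < k ∧ b ∈ B (k • lam) ∧ p = ((k : ℝ), toR b)}

/-- the Nakashima–Zelevinsky polytope `Δ_i(λ) = {a | (1, a) ∈ C_i(λ)}`. -/
def NZset {n N : ℕ} (B : (Fin n → ℤ) → Set (Fin N → ℤ)) (lam : Fin n → ℤ) : Set (Pt N) :=
  {a | ((1 : ℝ), a) ∈ NZcone B lam}

/-! ## Abstract crystal data

All the data attached to the crystal bases `B(λ)` of the irreducible highest weight
modules `V(λ)` of `g`, with each `B(λ)` identified with its image under the Kashiwara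
embedding `Ψ_i : B(λ) ↪ ℤ^N` associated with the fixed reduced word. -/

structure CrystalData (n N : ℕ) where
  /-- the Cartan matrix of `g` -/
  C : Fin n → Fin n → ℤ
  cartan : IsCartanMatrix C
  /-- the fixed reduced word `(i_1, …, i_N)` for the longest element `w₀` -/
  w : Fin N → Fin n
  reduced : IsReducedWordForLongest C (List.ofFn w)
  /-- `B lam` is the image `Ψ_i(B(λ))` of the crystal basis `B(λ)` under the Kashiwara
  embedding (for dominant `lam`) -/
  B : (Fin n → ℤ) → Set (Fin N → ℤ)
  B_finite : ∀ lam, (B lam).Finite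
  /-- the raising Kashiwara operator `ẽ_i` on `B(λ)`, transported to `ℤ^N`
  (`none` plays the role of `0`) -/
  e : (Fin n → ℤ) → Fin n → (Fin N → ℤ) → Option (Fin N → ℤ)
  /-- the lowering Kashiwara operator `f̃_i` on `B(λ)`, transported to `ℤ^N` -/
  f : (Fin n → ℤ) → Fin n → (Fin N → ℤ) → Option (Fin N → ℤ)
  e_mem : ∀ lam i a b, a ∈ B lam → e lam i a = some b → b ∈ B lam
  f_mem : ∀ lam i a b, a ∈ B lam → f lam i a = some b → b ∈ B lam
  e_iff_f : ∀ lam i a b, a ∈ B lam → b ∈ B lam → (e lam i a = some b ↔ f lam i b = some a)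
  /-- the highest weight element satisfies `Ψ_i(b_λ) = 0` -/
  highest_mem : ∀ lam, 0 ≤ lam → (0 : Fin N → ℤ) ∈ B lam
  /-- `lowest lam` is the image `Ψ_i(b_{w₀λ})` of the lowest weight element -/
  lowest : (Fin n → ℤ) → (Fin N → ℤ)
  lowest_mem : ∀ lam, 0 ≤ lam → lowest lam ∈ B lam
  lowest_f : ∀ lam i, 0 ≤ lam → f lam i (lowest lam) = none
  /-- Nakashima's theorem: `Ψ_i(b_{w₀λ}) = (x_1, …, x_N)` -/
  lowest_eq : ∀ lam, 0 ≤ lam → lowest lam = fun k => xCoord C w lam k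
  /-- additivity of the Kashiwara embedding -/
  add_mem : ∀ lam mu a b, 0 ≤ lam → 0 ≤ mu → a ∈ B lam → b ∈ B mu → a + b ∈ B (lam + mu)
  /-- the lattice points of the Nakashima–Zelevinsky polytope `Δ_i(λ)` are exactly
  `Ψ_i(B(λ))` -/
  lattice_points : ∀ lam, 0 ≤ lam → ∀ b : Fin N → ℤ, toR b ∈ NZset B lam ↔ b ∈ B lam

/-- iteration of a partially defined (`Option`-valued) operator. -/
def optIter {α : Type*} (g : α → Option α) : ℕ → α → Option α
  | 0, a => some a
  | j + 1, a => (optIter g j a).bind g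

/-- `opDem S lam m` : the image `Ψ_i(B^{w_{≥ m+1}}(λ))` of the opposite Demazure crystal,
defined through the recursion `B^{w_{≥1}}(λ) = {b_{w₀λ}}` and
`B^{w_{≥k+1}}(λ) = ⋃_{a ≥ 0} ẽ_{i_k}^a B^{w_{≥k}}(λ) \ {0}` (this recursion is exactly the
description of `B^w(λ)` by `ẽ`-monomials on `b_{w₀λ}` along a reduced word of `w w₀`). -/
def opDem {n N : ℕ} (S : CrystalData n N) (lam : Fin n → ℤ) : ℕ → Set (Fin N → ℤ)
  | 0 => {S.lowest lam}
  | m + 1 =>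
    if h : m < N then
      {b | ∃ a ∈ opDem S lam m, ∃ j : ℕ, optIter (S.e lam (S.w ⟨m, h⟩)) j a = some b}
    else opDem S lam m

/-- the point `a_λ = -Ψ_i(b_{w₀λ}) + (λ̂_{i_1}, …, λ̂_{i_N})`, where `λ̂` is determined by
`λ = ∑_i λ̂_i d_i α_i`. -/
def aPoint {n N : ℕ} (S : CrystalData n N) (lam : Fin n → ℤ) (lamHat : Fin n → ℝ) : Pt N :=
  fun k => lamHat (S.w k) - (S.lowest lam k : ℝ)

/-- the statement that `lamHat` gives the coordinates of `λ` in the basis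
`(d_i α_i)_i`, i.e. `λ = ∑_i λ̂_i d_i α_i`. -/
def IsHatCoords {n N : ℕ} (S : CrystalData n N) (lam : Fin n → ℤ) (lamHat : Fin n → ℝ) :
    Prop :=
  ∀ j, (lam j : ℝ) = ∑ i, lamHat i * (dcount S.w i : ℝ) * (S.C j i : ℝ)

/-- `-P + (λ̂_{i_1}, …, λ̂_{i_N})`. -/
def negTranslate {n N : ℕ} (w : Fin N → Fin n) (lamHat : Fin n → ℝ) (P : Set (Pt N)) :
    Set (Pt N) :=
  (fun x => fun k => lamHat (w k) - x k) '' P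

/-- the face `{a ∈ Δ_i(λ) | a_l = x_l for all l ≥ m}` (`0`-based `m`). -/
def NZface {n N : ℕ} (S : CrystalData n N) (lam : Fin n → ℤ) (m : ℕ) : Set (Pt N) :=
  {a ∈ NZset S.B lam | ∀ l : Fin N, m ≤ (l : ℕ) → a l = (xCoord S.C S.w lam l : ℝ)}

/-! ## The tensor product crystal `B̃_{c_1} ⊗ ⋯ ⊗ B̃_{c_M} ⊗ R_λ`

Concrete combinatorial model: an element is `a : Fin M → ℤ`, standing for
`(a_1)_{c_1} ⊗ ⋯ ⊗ (a_M)_{c_M} ⊗ r_λ`.  The crystal structure is computed by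
Kashiwara's tensor product rule. -/

/-- `σ_t(a) = a_t + ∑_{s<t} C (c_t) (c_s) * a_s` : the candidate value of `ε_{c_t}`
coming from the `t`-th tensor factor. -/
def tsig {n M : ℕ} (C : Fin n → Fin n → ℤ) (c : Fin M → Fin n) (a : Fin M → ℤ)
    (t : Fin M) : ℤ :=
  a t + ∑ s ∈ Finset.univ.filter (fun s => s < t), C (c t) (c s) * a s

/-- candidate value for `ε_i` at position `t : Fin (M+1)`: a tensor factor when
`t < M`, and the factor `R_λ` when `t = M`. -/
def tcand {n M : ℕ} (C : Fin n → Fin n → ℤ) (c : Fin M → Fin n) (lam : Fin n → ℤ)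
    (i : Fin n) (a : Fin M → ℤ) (t : Fin (M + 1)) : ℤ :=
  if h : (t : ℕ) < M then tsig C c a ⟨t, h⟩
  else -lam i + ∑ s, C i (c s) * a s

/-- positions relevant to the letter `i` (the factors with letter `i`, and `R_λ`). -/
def tvalid {n M : ℕ} (c : Fin M → Fin n) (i : Fin n) : Finset (Fin (M + 1)) :=
  Finset.univ.filter fun t => if h : (t : ℕ) < M then c ⟨t, h⟩ = i else True

lemma tvalid_nonempty {n M : ℕ} (c : Fin M → Fin n) (i : Fin n) :
    (tvalid c i).Nonempty := by
  refine ⟨Fin.last M, ?_⟩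
  simp [tvalid]

/-- positions where the maximum of the `ε_i`-candidates is attained. -/
def targmax {n M : ℕ} (C : Fin n → Fin n → ℤ) (c : Fin M → Fin n) (lam : Fin n → ℤ)
    (i : Fin n) (a : Fin M → ℤ) : Finset (Fin (M + 1)) :=
  (tvalid c i).filter fun t => ∀ t' ∈ tvalid c i,
    tcand C c lam i a t' ≤ tcand C c lam i a t

lemma targmax_nonempty {n M : ℕ} (C : Fin n → Fin n → ℤ) (c : Fin M → Fin n)
    (lam : Fin n → ℤ) (i : Fin n) (a : Fin M → ℤ) :
    (targmax C c lam i a).Nonempty := by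
  obtain ⟨t, ht, hmax⟩ :=
    (tvalid c i).exists_max_image (tcand C c lam i a) (tvalid_nonempty c i)
  exact ⟨t, Finset.mem_filter.2 ⟨ht, hmax⟩⟩

/-- `ε_i` on the tensor product crystal. -/
def teps {n M : ℕ} (C : Fin n → Fin n → ℤ) (c : Fin M → Fin n) (lam : Fin n → ℤ)
    (i : Fin n) (a : Fin M → ℤ) : ℤ :=
  tcand C c lam i a ((targmax C c lam i a).min' (targmax_nonempty C c lam i a))

/-- `φ_i = ε_i + ⟨wt, h_i⟩` on the tensor product crystal. -/
def tphi {n M : ℕ} (C : Fin n → Fin n → ℤ) (c : Fin M → Fin n) (lam : Fin n → ℤ)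
    (i : Fin n) (a : Fin M → ℤ) : ℤ :=
  teps C c lam i a + lam i - ∑ s, C i (c s) * a s

/-- the raising operator `ẽ_i` on the tensor product crystal: it acts on the leftmost
position where the maximum is attained, and gives `0` (i.e. `none`) if that position is
the factor `R_λ`. -/
def te {n M : ℕ} (C : Fin n → Fin n → ℤ) (c : Fin M → Fin n) (lam : Fin n → ℤ)
    (i : Fin n) (a : Fin M → ℤ) : Option (Fin M → ℤ) :=
  let t0 := (targmax C c lam i a).min' (targmax_nonempty C c lam i a)
  if h : (t0 : ℕ) < M then some (Function.update a ⟨t0, h⟩ (a ⟨t0, h⟩ - 1)) else none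

/-- the lowering operator `f̃_i` on the tensor product crystal: it acts on the rightmost
position where the maximum is attained, and gives `0` (i.e. `none`) if that position is
the factor `R_λ`. -/
def tf {n M : ℕ} (C : Fin n → Fin n → ℤ) (c : Fin M → Fin n) (lam : Fin n → ℤ)
    (i : Fin n) (a : Fin M → ℤ) : Option (Fin M → ℤ) :=
  let t1 := (targmax C c lam i a).max' (targmax_nonempty C c lam i a)
  if h : (t1 : ℕ) < M then some (Function.update a ⟨t1, h⟩ (a ⟨t1, h⟩ + 1)) else none

/-- the letters `(i_{N-M+1}, …, i_N)` of the tensor product crystal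
`B̃_{i_{N-M+1}} ⊗ ⋯ ⊗ B̃_{i_N} ⊗ R_λ` (the last `M` letters of the word). -/
def windowLetters {n N : ℕ} (w : Fin N → Fin n) (M : ℕ) (hM : M ≤ N) : Fin M → Fin n :=
  fun t => w ⟨N - M + t, by have := t.isLt; omega⟩

/-- the element `x_{≥ N-M+1} = (x_{N-M+1}, …, x_N)` of the above tensor product crystal,
i.e. `π_{≥ N-M+1}(b_{w_{≥N-M+1} λ})` (by Nakashima's theorem). -/
def windowX {n N : ℕ} (C : Fin n → Fin n → ℤ) (w : Fin N → Fin n) (lam : Fin n → ℤ)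
    (M : ℕ) (hM : M ≤ N) : Fin M → ℤ :=
  fun t => xCoord C w lam ⟨N - M + t, by have := t.isLt; omega⟩

/-! ## Tensor products of `sl₂`-crystals

`B^{(i)}(m_1) ⊗ ⋯ ⊗ B^{(i)}(m_d)` : an element is `t : Fin d → ℤ` with
`0 ≤ t_l ≤ m_l`, standing for `f̃^{t_1} b_{m_1} ⊗ ⋯ ⊗ f̃^{t_d} b_{m_d}`. -/

def sl2cand {d : ℕ} (m t : Fin d → ℤ) (l : Fin d) : ℤ :=
  t l - ∑ s ∈ Finset.univ.filter (fun s => s < l), (m s - 2 * t s)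

def sl2argmax {d : ℕ} (m t : Fin d → ℤ) : Finset (Fin d) :=
  Finset.univ.filter fun l => ∀ l', sl2cand m t l' ≤ sl2cand m t l

/-- `ẽ` on a tensor product of `sl₂`-crystals. -/
def sl2e {d : ℕ} (m t : Fin d → ℤ) : Option (Fin d → ℤ) :=
  if h : (sl2argmax m t).Nonempty then
    let l0 := (sl2argmax m t).min' h
    if 0 < t l0 then some (Function.update t l0 (t l0 - 1)) else none
  else none

/-- `f̃` on a tensor product of `sl₂`-crystals. -/
def sl2f {d : ℕ} (m t : Fin d → ℤ) : Option (Fin d → ℤ) :=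
  if h : (sl2argmax m t).Nonempty then
    let l1 := (sl2argmax m t).max' h
    if t l1 < m l1 then some (Function.update t l1 (t l1 + 1)) else none
  else none

/-- the set of positions of the word carrying the letter `i`. -/
def letterSet {n N : ℕ} (w : Fin N → Fin n) (i : Fin n) : Finset (Fin N) :=
  Finset.univ.filter fun k => w k = i

/-- the increasing enumeration of the positions of the word carrying the letter `i`. -/
def letterPos {n N : ℕ} (w : Fin N → Fin n) (i : Fin n) (l : Fin (dcount w i)) : Fin N :=
  ((letterSet w i).orderIsoOfFin rfl l : Fin N)


/-! ## Normal fans, reflexive polytopes, and the Alexeev–Brion fan -/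

/-- the face of `P` on which the linear functional `x ↦ ∑ u_k x_k` is maximized. -/
def argmaxSet {N : ℕ} (P : Set (Pt N)) (u : Pt N) : Set (Pt N) :=
  {x | x ∈ P ∧ ∀ y ∈ P, ∑ k, u k * y k ≤ ∑ k, u k * x k}

/-- two polytopes have the same normal fan iff the partitions of the dual space by the
map `u ↦ (face of `P` maximizing `u`)` coincide. -/
def SameNormalFan {N : ℕ} (P Q : Set (Pt N)) : Prop :=
  ∀ u v : Pt N, argmaxSet P u = argmaxSet P v ↔ argmaxSet Q u = argmaxSet Q v

/-- the polar dual of `P`. -/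
def polarDual {N : ℕ} (P : Set (Pt N)) : Set (Pt N) :=
  {u | ∀ x ∈ P, ∑ k, u k * x k ≤ 1}

/-- `P` is a reflexive polytope: a lattice polytope containing `0` in its interior whose
polar dual is again a lattice polytope. -/
def IsReflexive {N : ℕ} (P : Set (Pt N)) : Prop :=
  IsLatticePolytope P ∧ (0 : Pt N) ∈ interior P ∧ IsLatticePolytope (polarDual P)

/-- projection killing the coordinates whose letter is `i`
(the projection `ℝ^N → (ℝ^{d_i})^⊥`). -/
def offProj {n N : ℕ} (w : Fin N → Fin n) (i : Fin n) (x : Pt N) : Pt N :=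
  fun k => if w k = i then 0 else x k

/-- `S_i = ⋃_{λ ∈ P_+} {(λ, Ψ_i(b)) | b ∈ B(λ)}`, viewed inside `P_ℝ × ℝ^N`. -/
def fullS {n N : ℕ} (S : CrystalData n N) : Set ((Fin n → ℝ) × Pt N) :=
  {p | ∃ (lam : Fin n → ℤ) (b : Fin N → ℤ), 0 ≤ lam ∧ b ∈ S.B lam ∧ p = (toR lam, toR b)}

/-- `C_i ⊂ P_ℝ × ℝ^N` : the smallest closed cone containing `S_i`. -/
def fullC {n N : ℕ} (S : CrystalData n N) : Set ((Fin n → ℝ) × Pt N) :=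
  smallestClosedCone (fullS S)

/-- `F` is a face of the convex set `T` : a closed convex extreme subset. -/
def IsFaceOf {E : Type*} [AddCommGroup E] [Module ℝ E] [TopologicalSpace E]
    (F T : Set E) : Prop :=
  Convex ℝ F ∧ IsClosed F ∧ IsExtreme ℝ T F

/-- image under the first projection of the relative interior of `τ`. -/
def proj1relint {n N : ℕ} (τ : Set ((Fin n → ℝ) × Pt N)) : Set (Fin n → ℝ) :=
  Prod.fst '' intrinsicInterior ℝ τ

/-- `σ_λ⁰ = ⋂_{τ ∈ F_λ} π₁(τ⁰)` where
`F_λ = {faces τ of C_i | λ ∈ π₁(τ⁰)}` (Alexeev–Brion). -/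
def sigmaZero {n N : ℕ} (S : CrystalData n N) (lam : Fin n → ℝ) : Set (Fin n → ℝ) :=
  ⋂ τ ∈ {τ : Set ((Fin n → ℝ) × Pt N) | IsFaceOf τ (fullC S) ∧ lam ∈ proj1relint τ},
    proj1relint τ

/-- `σ_λ`, the closure of `σ_λ⁰`. -/
def sigmaCone {n N : ℕ} (S : CrystalData n N) (lam : Fin n → ℝ) : Set (Fin n → ℝ) :=
  closure (sigmaZero S lam)

/-- the closed fundamental Weyl chamber `P_{ℝ,+}`. -/
def PplusR (n : ℕ) : Set (Fin n → ℝ) := {x | ∀ i, 0 ≤ x i}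

/-- the fan `Σ_i = {σ_λ | λ ∈ P_{ℝ,+}}` with support `P_{ℝ,+}`. -/
def fanSigma {n N : ℕ} (S : CrystalData n N) : Set (Set (Fin n → ℝ)) :=
  {σ | ∃ lam ∈ PplusR n, σ = sigmaCone S lam}


/-! ## Reduced words in the Weyl group -/

section ReducedWords

variable {n : ℕ} {C : Fin n → Fin n → ℤ}

/-- No strictly shorter word represents the same Weyl group element. -/
def IsReducedWord (C : Fin n → Fin n → ℤ) (ω : List (Fin n)) : Prop :=
  ∀ ω' : List (Fin n), wordAction C ω' = wordAction C ω → ω.length ≤ ω'.length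

lemma wordAction_cons_apply (i : Fin n) (ω : List (Fin n)) (lam : Fin n → ℤ) (j : Fin n) :
    wordAction C (i :: ω) lam j = wordAction C ω lam j - wordAction C ω lam i * C j i := rfl

lemma wordAction_append (ω ω' : List (Fin n)) :
    wordAction C (ω ++ ω') = wordAction C ω ∘ wordAction C ω' := by
  induction ω with
  | nil => rfl
  | cons i ω ih => funext lam; simp [wordAction, ih]

lemma wordAction_cons_cons (hC : IsCartanMatrix C) (i : Fin n) (ω : List (Fin n)) :
    wordAction C (i :: i :: ω) = wordAction C ω := by
  funext lam j
  simp only [wordAction_cons_apply, hC.diag]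
  ring

lemma IsReducedWord.of_append_left {ω ω' : List (Fin n)} (h : IsReducedWord C (ω ++ ω')) :
    IsReducedWord C ω := by
  intro υ hυ
  have := h (υ ++ ω') (by rw [wordAction_append, wordAction_append, hυ])
  simpa using this

lemma IsReducedWord.of_append_right {ω ω' : List (Fin n)} (h : IsReducedWord C (ω ++ ω')) :
    IsReducedWord C ω' := by
  intro υ hυ
  have := h (ω ++ υ) (by rw [wordAction_append, wordAction_append, hυ])
  simpa using this

/-- A word of the same length representing the same element is again reduced. -/
lemma IsReducedWord.congr {ω ω' : List (Fin n)} (h : IsReducedWord C ω)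
    (hact : wordAction C ω' = wordAction C ω) (hlen : ω'.length = ω.length) :
    IsReducedWord C ω' := fun υ hυ => hlen ▸ h υ (hυ.trans hact)

/-- The matrix of the simple reflection `s_i`. -/
def reflMatrix (C : Fin n → Fin n → ℤ) (i : Fin n) : Matrix (Fin n) (Fin n) ℤ :=
  1 - Matrix.vecMulVec (fun j => C j i) (Pi.single i 1)

lemma reflMatrix_mulVec (i : Fin n) (lam : Fin n → ℤ) :
    (reflMatrix C i).mulVec lam = simpleRefl C i lam := by
  funext j
  simp [reflMatrix, Matrix.sub_mulVec, Matrix.vecMulVec_mulVec, simpleRefl, mul_comm]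

lemma det_reflMatrix (hC : IsCartanMatrix C) (i : Fin n) : (reflMatrix C i).det = -1 := by
  rw [reflMatrix, sub_eq_add_neg, ← Matrix.neg_vecMulVec, Matrix.vecMulVec_eq Unit,
    Matrix.det_one_add_replicateCol_mul_replicateRow]
  simp [hC.diag]

lemma wordAction_eq_mulVec (ω : List (Fin n)) (lam : Fin n → ℤ) :
    wordAction C ω lam = ((ω.map (reflMatrix C)).prod).mulVec lam := by
  induction ω with
  | nil => simp [wordAction]
  | cons i ω ih => simp [wordAction, ih, ← Matrix.mulVec_mulVec, reflMatrix_mulVec]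

lemma even_length_iff (hC : IsCartanMatrix C) {ω ω' : List (Fin n)}
    (h : wordAction C ω = wordAction C ω') : Even ω.length ↔ Even ω'.length := by
  have hdet : ∀ υ : List (Fin n), ((υ.map (reflMatrix C)).prod).det = (-1) ^ υ.length := by
    intro υ
    induction υ with
    | nil => simp
    | cons i υ ih => simp [Matrix.det_mul, ih, det_reflMatrix hC, pow_succ]
  have hM : (ω.map (reflMatrix C)).prod = (ω'.map (reflMatrix C)).prod := by
    apply Matrix.mulVec_injective
    funext lam
    rw [← wordAction_eq_mulVec, ← wordAction_eq_mulVec, h]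
  have := congrArg Matrix.det hM
  rw [hdet, hdet] at this
  rw [← neg_one_pow_eq_one_iff_even (R := ℤ) (by norm_num), this,
    neg_one_pow_eq_one_iff_even (by norm_num)]

/-- The alternating word `i, j, i, …` of the given length. -/
def altWord : ℕ → Fin n → Fin n → List (Fin n)
  | 0, _, _ => []
  | k + 1, i, j => i :: altWord k j i

lemma altWord_length (k : ℕ) (i j : Fin n) : (altWord k i j).length = k := by
  induction k generalizing i j with
  | zero => rfl
  | succ k ih => simp [altWord, ih]

lemma exists_altWord_add (k r : ℕ) (i j : Fin n) :
    ∃ ω, altWord (k + r) i j = altWord k i j ++ ω := by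
  induction k generalizing i j with
  | zero => exact ⟨_, rfl⟩
  | succ k ih =>
    obtain ⟨ω, hω⟩ := ih j i
    exact ⟨ω, by rw [Nat.add_right_comm, altWord, hω, altWord, List.cons_append]⟩

/-- A reduced word in two letters starting with `i` is alternating. -/
lemma IsReducedWord.eq_altWord (hC : IsCartanMatrix C) {i j : Fin n} {ω : List (Fin n)}
    (h : IsReducedWord C (i :: ω)) (hω : ∀ l ∈ ω, l = i ∨ l = j) :
    ω = altWord ω.length j i := by
  induction ω generalizing i j with
  | nil => rfl
  | cons l ω ih =>
    obtain rfl | rfl := hω l (by simp)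
    · have := h ω (wordAction_cons_cons hC l ω).symm
      simp at this
    · rw [List.length_cons, altWord,
        ← ih (h.of_append_right (ω := [i])) fun m hm => (hω m (by simp [hm])).symm]

/-- If the alternating word of length `m + 2` represents an element of length at most `m`, then
reduced alternating words have length at most `m + 1`. -/
lemma IsReducedWord.altWord_lt {i j : Fin n} {k m : ℕ} (h : IsReducedWord C (altWord k i j))
    (hm : wordAction C (altWord m j i) = wordAction C (altWord (m + 2) i j)) : k < m + 2 := by
  by_contra! hk
  obtain ⟨r, rfl⟩ := Nat.exists_eq_add_of_le hk
  obtain ⟨ω, hω⟩ := exists_altWord_add (m + 2) r i j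
  rw [hω] at h
  have := h.of_append_left _ hm
  simp only [altWord_length] at this
  omega

lemma wordAction_altWord_nonneg_of_four_le (hC : IsCartanMatrix C) {i j : Fin n} (hij : i ≠ j)
    (h4 : 4 ≤ C i j * C j i) {μ : Fin n → ℤ} (hi : 0 ≤ μ i) (hj : 0 ≤ μ j) (k : ℕ) :
    0 ≤ wordAction C (altWord k j i) μ i ∧
      0 ≤ 2 * wordAction C (altWord k j i) μ i - C i j * wordAction C (altWord k j i) μ j := by
  induction k generalizing i j with
  | zero =>
    refine ⟨hi, ?_⟩
    have := mul_nonneg (neg_nonneg.2 (hC.off_diag i j hij)) hj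
    change 0 ≤ 2 * μ i - C i j * μ j
    linarith
  | succ k ih =>
    obtain ⟨h1, h2⟩ := ih hij.symm (by linarith) hj hi
    simp only [altWord, wordAction_cons_apply, hC.diag]
    generalize wordAction C (altWord k i j) μ i = p at *
    generalize wordAction C (altWord k i j) μ j = q at *
    have hA := hC.off_diag i j hij
    have hB := hC.off_diag j i hij.symm
    have hB' : C j i < 0 := lt_of_le_of_ne hB fun h => by simp [h] at h4
    have key : 0 ≤ 2 * p - C i j * q := by
      by_contra! hlt
      nlinarith
    constructor
    · nlinarith
    · linarith

lemma wordAction_altWord_nonneg (hC : IsCartanMatrix C) {i j : Fin n} (hij : i ≠ j)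
    {μ : Fin n → ℤ} (hi : 0 ≤ μ i) (hj : 0 ≤ μ j) {k : ℕ}
    (h : IsReducedWord C (altWord (k + 1) i j)) :
    0 ≤ wordAction C (altWord k j i) μ i := by
  by_cases h4 : 4 ≤ C i j * C j i
  · exact (wordAction_altWord_nonneg_of_four_le hC hij h4 hi hj k).1
  have hA := hC.off_diag i j hij
  have hB := hC.off_diag j i hij.symm
  have hz := hC.zero_iff i j
  have hcases : (C i j = 0 ∧ C j i = 0) ∨ (C i j = -1 ∧ C j i = -1) ∨
      (C i j = -1 ∧ C j i = -2) ∨ (C i j = -2 ∧ C j i = -1) ∨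
      (C i j = -1 ∧ C j i = -3) ∨ (C i j = -3 ∧ C j i = -1) := by
    by_cases h0 : C i j = 0
    · exact Or.inl ⟨h0, hz.1 h0⟩
    have h0' : C j i ≠ 0 := fun h => h0 (hz.2 h)
    have hA' : C i j ≤ -1 := by omega
    have hB' : C j i ≤ -1 := by omega
    have hA3 : -3 ≤ C i j := by nlinarith
    have hB3 : -3 ≤ C j i := by nlinarith
    generalize C i j = A at *
    generalize C j i = B at *
    interval_cases A <;> interval_cases B <;> simp_all
  have bound : ∀ m, wordAction C (altWord m j i) = wordAction C (altWord (m + 2) i j) →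
      k < m + 1 := fun m hm => by have := h.altWord_lt hm; omega
  rcases hcases with ⟨a, b⟩ | ⟨a, b⟩ | ⟨a, b⟩ | ⟨a, b⟩ | ⟨a, b⟩ | ⟨a, b⟩ <;>
    [have hk := bound 1; have hk := bound 2; have hk := bound 3; have hk := bound 3;
      have hk := bound 5; have hk := bound 5]
  all_goals
    specialize hk (by
      funext lam l
      simp only [altWord, wordAction, simpleRefl, id, hC.diag, a, b]
      ring)
    interval_cases k <;> simp only [altWord, wordAction, simpleRefl, id, hC.diag, a, b] <;> linarith

/-- If `i :: ω` is reduced then `⟨ω λ, h_i⟩ ≥ 0` for every dominant weight `λ`. -/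
lemma IsReducedWord.wordAction_nonneg (hC : IsCartanMatrix C) {i : Fin n} {ω : List (Fin n)}
    (h : IsReducedWord C (i :: ω)) {lam : Fin n → ℤ} (hlam : 0 ≤ lam) :
    0 ≤ wordAction C ω lam i := by
  induction hl : ω.length using Nat.strong_induction_on generalizing i ω with
  | _ r ih =>
  subst hl
  rcases ω with _ | ⟨j, ω⟩
  · exact hlam i
  have hij : i ≠ j := by
    rintro rfl
    have := h ω (wordAction_cons_cons hC i ω).symm
    simp at this
  let Q : ℕ → Prop := fun m => ∃ a v : List (Fin n), (∀ l ∈ a, l = i ∨ l = j) ∧ v.length = m ∧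
    a.length + v.length = (j :: ω).length ∧ wordAction C (a ++ v) = wordAction C (j :: ω)
  have hQ : Q ω.length := ⟨[j], ω, by simp, rfl, by simp; omega, rfl⟩
  have hle : Nat.find ⟨_, hQ⟩ ≤ ω.length := Nat.find_min' _ hQ
  obtain ⟨a, v, ha, hv, hlen, hact⟩ := Nat.find_spec ⟨_, hQ⟩
  have hred : IsReducedWord C (i :: a ++ v) := by
    refine h.congr ?_ (by simpa using hlen)
    funext μ
    simp [wordAction, hact]
  have hvred : IsReducedWord C v := hred.of_append_right
  have hpos : ∀ l, (l = i ∨ l = j) → 0 ≤ wordAction C v lam l := by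
    intro l hl
    refine ih v.length (by simp; omega) ?_ rfl
    intro υ hυ
    by_contra! hlt
    have hpar := even_length_iff hC hυ
    have hυ' : wordAction C (l :: υ) = wordAction C v := by
      rw [← wordAction_cons_cons hC l v]
      funext μ
      simp only [wordAction] at hυ ⊢
      rw [hυ]
    have h1 := hvred _ hυ'
    simp only [List.length_cons, Nat.even_add_one] at hlt hpar h1
    have h2 : υ.length + 1 = v.length := by
      rcases (by omega : υ.length = v.length ∨ υ.length + 1 = v.length) with e | e
      · rw [e] at hpar; tauto
      · exact e
    refine Nat.find_min ⟨_, hQ⟩ (m := υ.length) (by omega)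
      ⟨a ++ [l], υ, ?_, rfl, ?_, ?_⟩
    · intro m hm
      rcases List.mem_append.1 hm with hm | hm
      · exact ha m hm
      · rwa [List.mem_singleton.1 hm]
    · rw [← hlen]; simp; omega
    · rw [List.append_assoc, List.singleton_append, wordAction_append, hυ', ← wordAction_append,
        hact]
  have hia : IsReducedWord C (i :: a) := hred.of_append_left
  rw [← hact, wordAction_append, Function.comp_apply, hia.eq_altWord hC ha]
  refine wordAction_altWord_nonneg hC hij (hpos i (Or.inl rfl)) (hpos j (Or.inr rfl)) ?_
  rwa [altWord, ← hia.eq_altWord hC ha]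

end ReducedWords

/-! ## The elements `(y) ⊗ x_{≥ k}` of the tensor product crystal -/

section Window

variable {n N : ℕ} (C : Fin n → Fin n → ℤ) (w : Fin N → Fin n) (lam : Fin n → ℤ)

lemma drop_ofFn (k : Fin N) :
    (List.ofFn w).drop k = w k :: (List.ofFn w).drop (k + 1) := by
  rw [List.drop_eq_getElem_cons (by simp)]
  simp

variable {C} in
lemma xCoord_eq (hC : IsCartanMatrix C) (k : Fin N) :
    xCoord C w lam k = wordAction C ((List.ofFn w).drop (k + 1)) lam (w k) := by
  rw [xCoord, drop_ofFn, wordAction_cons_apply, hC.diag]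
  ring

variable {C w lam} in
lemma xCoord_nonneg (hC : IsCartanMatrix C) (hw : IsReducedWord C (List.ofFn w))
    (hlam : 0 ≤ lam) (k : Fin N) : 0 ≤ xCoord C w lam k := by
  rw [xCoord_eq w lam hC]
  rw [← List.take_append_drop k (List.ofFn w), drop_ofFn] at hw
  exact hw.of_append_right.wordAction_nonneg hC hlam

variable {C} in
/-- The partial sums `∑_{s < t} ⟨x_s α_s, h_j⟩` telescope. -/
lemma sum_windowX (hC : IsCartanMatrix C) {M : ℕ} (hM : M ≤ N) (j : Fin n) {t : ℕ} (ht : t ≤ M) :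
    ∑ s ∈ Finset.univ.filter (fun s : Fin M => (s : ℕ) < t),
        C j (windowLetters w M hM s) * windowX C w lam M hM s
      = wordAction C ((List.ofFn w).drop (N - M + t)) lam j
        - wordAction C ((List.ofFn w).drop (N - M)) lam j := by
  induction t with
  | zero => simp
  | succ t ih =>
    have hset : Finset.univ.filter (fun s : Fin M => (s : ℕ) < t + 1)
        = insert ⟨t, ht⟩ (Finset.univ.filter fun s : Fin M => (s : ℕ) < t) := by
      ext s
      simp [Fin.ext_iff]
      omega
    rw [hset, Finset.sum_insert (by simp), ih (by omega)]
    have hd := drop_ofFn w ⟨N - M + t, by omega⟩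
    simp only at hd
    rw [hd, wordAction_cons_apply]
    simp only [windowX, windowLetters, xCoord_eq w lam hC]
    ring_nf

/-- The element `(y)_{i_{k-1}} ⊗ x_{≥ k}`. -/
def consX (M : ℕ) (hM : M + 1 ≤ N) (y : ℤ) : Fin (M + 1) → ℤ :=
  Fin.cons y (windowX C w lam M (Nat.le_of_succ_le hM))

lemma consX_head (M : ℕ) (hM : M + 1 ≤ N) :
    consX C w lam M hM (windowX C w lam (M + 1) hM 0) = windowX C w lam (M + 1) hM := by
  funext t
  refine Fin.cases rfl (fun t => ?_) t
  simp only [consX, Fin.cons_succ, windowX]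
  congr 1
  ext
  simp
  omega

lemma update_consX (M : ℕ) (hM : M + 1 ≤ N) (y z : ℤ) :
    Function.update (consX C w lam M hM y) 0 z = consX C w lam M hM z :=
  Fin.update_cons_zero _ _ _

lemma consX_of_ne_zero (M : ℕ) (hM : M + 1 ≤ N) (y : ℤ) {t : Fin (M + 1)} (ht : t ≠ 0) :
    consX C w lam M hM y t = windowX C w lam (M + 1) hM t := by
  rw [← consX_head C w lam M hM, ← update_consX C w lam M hM y (windowX C w lam (M + 1) hM 0),
    Function.update_of_ne ht]

variable {C} in
lemma sum_consX (hC : IsCartanMatrix C) {M : ℕ} (hM : M + 1 ≤ N) (y : ℤ) {t : ℕ} (h0 : 0 < t)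
    (ht : t ≤ M + 1) :
    ∑ s ∈ Finset.univ.filter (fun s : Fin (M + 1) => (s : ℕ) < t),
        C (windowLetters w (M + 1) hM 0) (windowLetters w (M + 1) hM s) * consX C w lam M hM y s
      = wordAction C ((List.ofFn w).drop (N - (M + 1) + t)) lam (windowLetters w (M + 1) hM 0)
        + 2 * y - windowX C w lam (M + 1) hM 0 := by
  have hmem : (0 : Fin (M + 1)) ∈ Finset.univ.filter (fun s : Fin (M + 1) => (s : ℕ) < t) := by
    simpa using h0
  have h := sum_windowX w lam hC hM (windowLetters w (M + 1) hM 0) ht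
  rw [← Finset.add_sum_erase _ _ hmem, hC.diag] at h ⊢
  have hrest : ∀ s ∈ (Finset.univ.filter (fun s : Fin (M + 1) => (s : ℕ) < t)).erase 0,
      C (windowLetters w (M + 1) hM 0) (windowLetters w (M + 1) hM s) * consX C w lam M hM y s
        = C (windowLetters w (M + 1) hM 0) (windowLetters w (M + 1) hM s)
          * windowX C w lam (M + 1) hM s := by
    intro s hs
    rw [consX_of_ne_zero C w lam M hM y (Finset.ne_of_mem_erase hs)]
  rw [Finset.sum_congr rfl hrest]
  have hx : windowX C w lam (M + 1) hM 0
      = -wordAction C ((List.ofFn w).drop (N - (M + 1))) lam (windowLetters w (M + 1) hM 0) := rfl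
  have h0' : consX C w lam M hM y 0 = y := rfl
  rw [h0']
  linarith

lemma tcand_consX_zero (M : ℕ) (hM : M + 1 ≤ N) (y : ℤ) :
    tcand C (windowLetters w (M + 1) hM) lam (windowLetters w (M + 1) hM 0)
      (consX C w lam M hM y) 0 = y := by
  simp [tcand, tsig, consX]

variable {C} in
lemma tcand_consX (hC : IsCartanMatrix C) {M : ℕ} (hM : M + 1 ≤ N) (y : ℤ) {t : Fin (M + 1 + 1)}
    (ht : t ∈ tvalid (windowLetters w (M + 1) hM) (windowLetters w (M + 1) hM 0)) (h0 : t ≠ 0) :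
    tcand C (windowLetters w (M + 1) hM) lam (windowLetters w (M + 1) hM 0)
      (consX C w lam M hM y) t = 2 * y - windowX C w lam (M + 1) hM 0 := by
  have ht0 : 0 < (t : ℕ) := Nat.pos_of_ne_zero fun h => h0 (Fin.ext h)
  have hsum := sum_consX w lam hC hM y ht0 (by omega)
  rw [tcand]
  split_ifs with h
  · simp only [tvalid, Finset.mem_filter, Finset.mem_univ, true_and, h, dif_pos] at ht
    have hval : consX C w lam M hM y ⟨t, h⟩ = windowX C w lam (M + 1) hM ⟨t, h⟩ :=
      consX_of_ne_zero C w lam M hM y fun e => ht0.ne' (congrArg Fin.val e)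
    simp only [tsig, Fin.lt_def]
    rw [ht, hsum, hval, windowX, xCoord]
    have hl : w ⟨N - (M + 1) + t, by omega⟩ = windowLetters w (M + 1) hM 0 := ht
    simp only [hl]
    ring
  · have htM : (t : ℕ) = M + 1 := by omega
    rw [Finset.filter_true_of_mem (fun s _ => by omega)] at hsum
    rw [hsum, htM, Nat.sub_add_cancel hM, List.drop_of_length_le (by simp), wordAction, id]
    ring

lemma zero_mem_tvalid {m : ℕ} (c : Fin (m + 1) → Fin n) :
    (0 : Fin (m + 1 + 1)) ∈ tvalid c (c 0) := by
  simp [tvalid]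

variable {C} in
lemma min'_targmax_consX (hC : IsCartanMatrix C) {M : ℕ} (hM : M + 1 ≤ N) {y : ℤ}
    (hy : y ≤ windowX C w lam (M + 1) hM 0) :
    (targmax C (windowLetters w (M + 1) hM) lam (windowLetters w (M + 1) hM 0)
      (consX C w lam M hM y)).min' (targmax_nonempty ..) = 0 := by
  refine le_antisymm (Finset.min'_le _ _ (Finset.mem_filter.2 ⟨zero_mem_tvalid _, ?_⟩))
    (Fin.zero_le _)
  intro t ht
  rw [tcand_consX_zero]
  rcases eq_or_ne t 0 with rfl | h0
  · rw [tcand_consX_zero]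
  · rw [tcand_consX w lam hC hM y ht h0]
    linarith

variable {C} in
lemma max'_targmax_consX (hC : IsCartanMatrix C) {M : ℕ} (hM : M + 1 ≤ N) {y : ℤ}
    (hy : y < windowX C w lam (M + 1) hM 0) :
    (targmax C (windowLetters w (M + 1) hM) lam (windowLetters w (M + 1) hM 0)
      (consX C w lam M hM y)).max' (targmax_nonempty ..) = 0 := by
  obtain ⟨hv, hmax⟩ := Finset.mem_filter.1 (Finset.max'_mem (targmax C (windowLetters w (M + 1) hM)
    lam (windowLetters w (M + 1) hM 0) (consX C w lam M hM y)) (targmax_nonempty ..))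
  by_contra h0
  have h := hmax 0 (zero_mem_tvalid _)
  rw [tcand_consX_zero, tcand_consX w lam hC hM y hv h0] at h
  linarith

variable {C} in
lemma teps_consX (hC : IsCartanMatrix C) {M : ℕ} (hM : M + 1 ≤ N) {y : ℤ}
    (hy : y ≤ windowX C w lam (M + 1) hM 0) :
    teps C (windowLetters w (M + 1) hM) lam (windowLetters w (M + 1) hM 0)
      (consX C w lam M hM y) = y := by
  rw [teps, min'_targmax_consX w lam hC hM hy, tcand_consX_zero]

variable {C} in
lemma tphi_consX (hC : IsCartanMatrix C) {M : ℕ} (hM : M + 1 ≤ N) {y : ℤ}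
    (hy : y ≤ windowX C w lam (M + 1) hM 0) :
    tphi C (windowLetters w (M + 1) hM) lam (windowLetters w (M + 1) hM 0)
      (consX C w lam M hM y) = windowX C w lam (M + 1) hM 0 - y := by
  have hsum := sum_consX w lam hC hM y (Nat.succ_pos M) le_rfl
  rw [Finset.filter_true_of_mem (fun s _ => s.isLt), Nat.sub_add_cancel hM,
    List.drop_of_length_le (by simp), wordAction, id] at hsum
  rw [tphi, teps_consX w lam hC hM hy, hsum]
  ring

variable {C} in
lemma te_consX (hC : IsCartanMatrix C) {M : ℕ} (hM : M + 1 ≤ N) {y : ℤ}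
    (hy : y ≤ windowX C w lam (M + 1) hM 0) :
    te C (windowLetters w (M + 1) hM) lam (windowLetters w (M + 1) hM 0)
      (consX C w lam M hM y) = some (consX C w lam M hM (y - 1)) := by
  simp only [te, min'_targmax_consX w lam hC hM hy]
  exact congrArg some (update_consX C w lam M hM y (y - 1))

variable {C} in
lemma tf_consX (hC : IsCartanMatrix C) {M : ℕ} (hM : M + 1 ≤ N) {y : ℤ}
    (hy : y < windowX C w lam (M + 1) hM 0) :
    tf C (windowLetters w (M + 1) hM) lam (windowLetters w (M + 1) hM 0)
      (consX C w lam M hM y) = some (consX C w lam M hM (y + 1)) := by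
  simp only [tf, max'_targmax_consX w lam hC hM hy]
  exact congrArg some (update_consX C w lam M hM y (y + 1))

variable {C} in
lemma optIter_te_consX (hC : IsCartanMatrix C) {M : ℕ} (hM : M + 1 ≤ N) {y : ℤ}
    (hy : y ≤ windowX C w lam (M + 1) hM 0) (r : ℕ) :
    optIter (te C (windowLetters w (M + 1) hM) lam (windowLetters w (M + 1) hM 0)) r
      (consX C w lam M hM y) = some (consX C w lam M hM (y - r)) := by
  induction r with
  | zero => simp [optIter]
  | succ r ih =>
    rw [optIter, ih, Option.bind_some, te_consX w lam hC hM (by omega)]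
    push_cast
    ring_nf

variable {C} in
lemma optIter_tf_consX (hC : IsCartanMatrix C) {M : ℕ} (hM : M + 1 ≤ N) {y : ℤ} {r : ℕ}
    (hy : y + r ≤ windowX C w lam (M + 1) hM 0) :
    optIter (tf C (windowLetters w (M + 1) hM) lam (windowLetters w (M + 1) hM 0)) r
      (consX C w lam M hM y) = some (consX C w lam M hM (y + r)) := by
  induction r with
  | zero => simp [optIter]
  | succ r ih =>
    push_cast at hy
    rw [optIter, ih (by omega), Option.bind_some, tf_consX w lam hC hM (by omega)]
    push_cast
    ring_nf

end Window

/-- Lemma on the elements `x_{≥k}`.  For `2 ≤ k ≤ N` write `M := N-k+1`,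
so that in the tensor product crystal `B̃_{i_{k-1}} ⊗ B̃_{i_k} ⊗ ⋯ ⊗ B̃_{i_N} ⊗ R_λ`
(letters `windowLetters w (M+1)`) one has the element `x_{≥k-1} = windowX C w lam (M+1)`,
while `x_{≥k} = windowX C w lam M`, the letter `i_{k-1}` is `windowLetters w (M+1) h2 0`,
and `x_{k-1} = windowX C w lam (M+1) h2 0`.  Then
`ε_{i_{k-1}}(x_{≥k-1}) = x_{k-1}`, `ẽ_{i_{k-1}}^{x_{k-1}} x_{≥k-1} = (0)_{i_{k-1}} ⊗ x_{≥k}`,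
`φ_{i_{k-1}}((0)_{i_{k-1}} ⊗ x_{≥k}) = x_{k-1}`, and
`f̃_{i_{k-1}}^{x_{k-1}}((0)_{i_{k-1}} ⊗ x_{≥k}) = x_{≥k-1}`. -/
theorem statement5 {n N : ℕ} (C : Fin n → Fin n → ℤ) (hC : IsCartanMatrix C)
    (w : Fin N → Fin n) (hw : IsReducedWordForLongest C (List.ofFn w))
    (lam : Fin n → ℤ) (hlam : 0 ≤ lam)
    (M : ℕ) (h1 : 1 ≤ M) (h2 : M + 1 ≤ N) :
    teps C (windowLetters w (M + 1) h2) lam (windowLetters w (M + 1) h2 0)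
        (windowX C w lam (M + 1) h2) = windowX C w lam (M + 1) h2 0 ∧
    optIter (te C (windowLetters w (M + 1) h2) lam (windowLetters w (M + 1) h2 0))
        (windowX C w lam (M + 1) h2 0).toNat (windowX C w lam (M + 1) h2)
      = some (Fin.cons 0 (windowX C w lam M (by omega))) ∧
    tphi C (windowLetters w (M + 1) h2) lam (windowLetters w (M + 1) h2 0)
        (Fin.cons 0 (windowX C w lam M (by omega))) = windowX C w lam (M + 1) h2 0 ∧
    optIter (tf C (windowLetters w (M + 1) h2) lam (windowLetters w (M + 1) h2 0))
        (windowX C w lam (M + 1) h2 0).toNat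
        (Fin.cons 0 (windowX C w lam M (by omega)))
      = some (windowX C w lam (M + 1) h2) := by
  have hx : 0 ≤ windowX C w lam (M + 1) h2 0 := xCoord_nonneg hC hw.1 hlam _
  refine ⟨?_, ?_, ?_, ?_⟩
  · conv_lhs => rw [← consX_head]
    exact teps_consX w lam hC h2 le_rfl
  · have h := optIter_te_consX w lam hC h2 le_rfl (windowX C w lam (M + 1) h2 0).toNat
    rwa [consX_head, Int.toNat_of_nonneg hx, sub_self] at h
  · exact (tphi_consX w lam hC h2 hx).trans (sub_zero _)
  · have h := optIter_tf_consX w lam hC h2 (y := 0) (r := (windowX C w lam (M + 1) h2 0).toNat)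
      (by rw [Int.toNat_of_nonneg hx, zero_add])
    rwa [Int.toNat_of_nonneg hx, zero_add, consX_head] at h

end NZ
end
end

section
/- Let G = SL_4(ℂ) and take the reduced word i = (2,1,2,3,2,1) for w_0, so that the linear functions are l_1(a) = l_3(a) = a_1^{(2)} + a_2^{(2)} + a_3^{(2)} and l_2(a) = a_1^{(1)} + a_2^{(1)} + a_1^{(3)} on ℝ^6 = ℝ^2 ⊕ ℝ^3 ⊕ ℝ. For the point a_low := −(5/4, 1/4, 1/3, 1/3, 4/3, 3/2), the iterates D_2^{(1)}(a_low), D_1^{(2)}D_2^{(1)}(a_low), D_2^{(3)}D_1^{(2)}D_2^{(1)}(a_low) are well-defined parapolytopes and D_3^{(4)}D_2^{(3)}D_1^{(2)}D_2^{(1)}(a_low) is a well-defined convex polytope, but D_3^{(4)}D_2^{(3)}D_1^{(2)}D_2^{(1)}(a_low) is not a parapolytope: its slice at c = (−1/4, −1/4, 0, 0, 0, 1/2) ∈ (ℝ^{d_2})^⊥ is {(a_1^{(2)}, a_2^{(2)}, a_3^{(2)}) | −1/3 ≤ a_1^{(2)} ≤ 2/3, −a_1^{(2)} + 1/3 ≤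 a_2^{(2)} ≤ 2/3, a_3^{(2)} = −4/3}, which is not a coordinate box. Consequently D_2^{(5)}D_3^{(4)}D_2^{(3)}D_1^{(2)}D_2^{(1)}(a_low) is not well-defined. -/
open scoped BigOperators Pointwise Classical

noncomputable section

namespace NZ

/-! ## Statement 19: the counterexample for `SL₄(ℂ)` -/

/-- the Cartan matrix of type `A₃` (i.e. of `SL₄(ℂ)`). -/
def cartanA3 : Fin 3 → Fin 3 → ℤ := ![![2, -1, 0], ![-1, 2, -1], ![0, -1, 2]]

/-- the reduced word `i = (2, 1, 2, 3, 2, 1)` for `w₀` (`0`-based letters). -/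
def wordA3 : Fin 6 → Fin 3 := ![1, 0, 1, 2, 1, 0]

/-- the point `a_low = -(5/4, 1/4, 1/3, 1/3, 4/3, 3/2) ∈ ℝ² ⊕ ℝ³ ⊕ ℝ`, written in the
word coordinates `(a_1, …, a_6)` (the positions `2, 6` carry the letter `1`, the
positions `1, 3, 5` the letter `2`, and the position `4` the letter `3`). -/
def aLow : Pt 6 := ![-(1/3 : ℝ), -(5/4), -(1/3), -(3/2), -(4/3), -(1/4)]

/-- the point `c = (-1/4, -1/4, 0, 0, 0, 1/2) ∈ (ℝ^{d_2})^⊥`, in word coordinates. -/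
def cLow : Pt 6 := ![0, -(1/4 : ℝ), 0, 1/2, 0, -(1/4)]

/-! ### The word `(2, 1, 2, 3, 2, 1)` is reduced and represents the longest element -/

/-- `wordAction` as a linear map. -/
def wordLinearMap {n : ℕ} (C : Fin n → Fin n → ℤ) (ω : List (Fin n)) :
    (Fin n → ℤ) →ₗ[ℤ] (Fin n → ℤ) where
  toFun := wordAction C ω
  map_add' x y := by
    induction ω with
    | nil => rfl
    | cons i ω ih => funext j; simp only [wordAction, simpleRefl, ih, Pi.add_apply]; ring
  map_smul' c x := by
    induction ω with
    | nil => rfl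
    | cons i ω ih =>
      funext j
      simp only [wordAction, simpleRefl, ih, Pi.smul_apply, smul_eq_mul, RingHom.id_apply]
      ring

lemma wordAction_ext {n : ℕ} {C : Fin n → Fin n → ℤ} {ω ω' : List (Fin n)}
    (h : ∀ i j, wordAction C ω (Pi.single i 1) j = wordAction C ω' (Pi.single i 1) j) :
    wordAction C ω = wordAction C ω' := by
  have : wordLinearMap C ω = wordLinearMap C ω' :=
    (Pi.basisFun ℤ (Fin n)).ext fun i => by
      rw [Pi.basisFun_apply]; exact funext (h i)
  exact congrArg DFunLike.coe this

/-- The number of positive coroots of type `A₃` pairing negatively with a weight. -/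
def negCoroots (lam : Fin 3 → ℤ) : ℕ :=
  (if lam 0 < 0 then 1 else 0) + (if lam 1 < 0 then 1 else 0) + (if lam 2 < 0 then 1 else 0) +
    (if lam 0 + lam 1 < 0 then 1 else 0) + (if lam 1 + lam 2 < 0 then 1 else 0) +
    (if lam 0 + lam 1 + lam 2 < 0 then 1 else 0)

lemma negCoroots_simpleRefl_le (i : Fin 3) (lam : Fin 3 → ℤ) :
    negCoroots (simpleRefl cartanA3 i lam) ≤ negCoroots lam + 1 := by
  fin_cases i <;>
    simp [negCoroots, simpleRefl, cartanA3] <;> grind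

lemma negCoroots_wordAction_le (ω : List (Fin 3)) :
    negCoroots (wordAction cartanA3 ω 1) ≤ ω.length := by
  induction ω with
  | nil => simp [wordAction, negCoroots]
  | cons i ω ih =>
    exact (negCoroots_simpleRefl_le i _).trans (Nat.succ_le_succ ih)

/-- Normal forms of the elements of the Weyl group of type `A₃`. -/
def normalFormsA3 : List (List (Fin 3)) := do
  let a ← [[], [0]]
  let b ← [[], [1], [1, 0]]
  let c ← [[], [2], [2, 1], [2, 1, 0]]
  return a ++ b ++ c

lemma exists_normalForm_cons : ∀ ω ∈ normalFormsA3, ∀ i, ∃ ω' ∈ normalFormsA3, ∀ j k,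
    wordAction cartanA3 ω' (Pi.single j 1) k =
      wordAction cartanA3 (i :: ω) (Pi.single j 1) k := by
  decide +kernel

lemma exists_normalForm (ω : List (Fin 3)) :
    ∃ ω' ∈ normalFormsA3, wordAction cartanA3 ω' = wordAction cartanA3 ω := by
  induction ω with
  | nil => exact ⟨[], by decide, rfl⟩
  | cons i ω ih =>
    obtain ⟨ω', hmem, h⟩ := ih
    obtain ⟨ω'', hmem', h'⟩ := exists_normalForm_cons ω' hmem i
    refine ⟨ω'', hmem', (wordAction_ext h').trans ?_⟩
    simp only [wordAction, h]

lemma isReducedWordForLongest_wordA3 :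
    IsReducedWordForLongest cartanA3 (List.ofFn wordA3) := by
  constructor
  · intro ω h
    have hlow : negCoroots (wordAction cartanA3 (List.ofFn wordA3) 1) = 6 := by decide +kernel
    have := negCoroots_wordAction_le ω
    rw [h, hlow] at this
    simpa using this
  · intro ω
    obtain ⟨τ, hmem, h⟩ := exists_normalForm ω
    have hlen : ∀ τ ∈ normalFormsA3, τ.length ≤ 6 := by decide
    exact ⟨τ, by simpa using hlen τ hmem, h⟩

/-! ### Polytopes fibred over polytopes -/

lemma IsConvexPolytope.update_Icc {N : ℕ} {P : Set (Pt N)} (hP : IsConvexPolytope P) (k : Fin N)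
    (f g : Pt N →ᵃ[ℝ] ℝ) (hfg : ∀ x ∈ P, f x ≤ g x) :
    IsConvexPolytope {y | ∃ x ∈ P, ∃ t ∈ Set.Icc (f x) (g x), y = Function.update x k t} := by
  obtain ⟨V, rfl⟩ := hP
  have hcomb : ∀ (a b s t : ℝ) (x y : Pt N),
      a • Function.update x k s + b • Function.update y k t =
        Function.update (a • x + b • y) k (a * s + b * t) := by
    intro a b s t x y
    funext l
    by_cases hl : l = k
    · subst hl; simp
    · simp [hl]
  let up (h : Pt N →ᵃ[ℝ] ℝ) (x : Pt N) : Pt N := Function.update x k (h x)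
  refine ⟨V.image (up f) ∪ V.image (up g), ?_⟩
  set T : Set (Pt N) := ((V.image (up f) ∪ V.image (up g) : Finset (Pt N)) : Set (Pt N)) with hT
  have hmem : ∀ h : Pt N →ᵃ[ℝ] ℝ, (∀ v ∈ V, up h v ∈ T) →
      ∀ x ∈ convexHull ℝ (V : Set (Pt N)), up h x ∈ convexHull ℝ T := by
    intro h hV
    refine fun x hx => convexHull_min (t := {x | up h x ∈ convexHull ℝ T})
      (fun v hv => subset_convexHull ℝ _ (hV v hv)) ?_ hx
    intro x hx y hy a b ha hb hab
    have := convex_convexHull ℝ T hx hy ha hb hab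
    simp only [up, hcomb] at this
    have hh : h (a • x + b • y) = a * h x + b * h y :=
      Convex.combo_affine_apply hab
    simpa only [Set.mem_ofPred_eq, up, hh] using this
  apply Set.Subset.antisymm
  · rintro _ ⟨x, hx, t, ht, rfl⟩
    have hf := hmem f (fun v hv => by
      simp only [hT, Finset.coe_union, Finset.coe_image]
      exact Or.inl ⟨v, hv, rfl⟩) x hx
    have hg := hmem g (fun v hv => by
      simp only [hT, Finset.coe_union, Finset.coe_image]
      exact Or.inr ⟨v, hv, rfl⟩) x hx
    obtain ⟨a, b, ha, hb, hab, rfl⟩ := (Convex.mem_Icc (hfg x hx)).1 ht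
    have := convex_convexHull ℝ T hf hg ha hb hab
    simpa only [up, hcomb, ← add_smul, hab, one_smul] using this
  · refine convexHull_min ?_ ?_
    · intro y hy
      simp only [hT, Finset.coe_union, Finset.coe_image] at hy
      rcases hy with ⟨v, hv, rfl⟩ | ⟨v, hv, rfl⟩
      all_goals have hv' := subset_convexHull ℝ (V : Set (Pt N)) hv
      · exact ⟨v, hv', f v, ⟨le_rfl, hfg v hv'⟩, rfl⟩
      · exact ⟨v, hv', g v, ⟨hfg v hv', le_rfl⟩, rfl⟩
    · rintro _ ⟨x, hx, s, hs, rfl⟩ _ ⟨y, hy, t, ht, rfl⟩ a b ha hb hab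
      refine ⟨a • x + b • y, convex_convexHull ℝ _ hx hy ha hb hab, a * s + b * t, ?_,
        hcomb a b s t x y⟩
      have hf : f (a • x + b • y) = a * f x + b * f y := Convex.combo_affine_apply hab
      have hg : g (a • x + b • y) = a * g x + b * g y := Convex.combo_affine_apply hab
      rw [hf, hg]
      exact ⟨add_le_add (mul_le_mul_of_nonneg_left hs.1 ha) (mul_le_mul_of_nonneg_left ht.1 hb),
        add_le_add (mul_le_mul_of_nonneg_left hs.2 ha) (mul_le_mul_of_nonneg_left ht.2 hb)⟩

/-! ### Slices and Demazure operators -/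

lemma slice_eq_of_mem {n N : ℕ} {w : Fin N → Fin n} {i : Fin n} {c x : Pt N}
    (h : x ∈ slice w i c) : slice w i x = slice w i c := by
  ext y
  exact forall₂_congr fun k hk => by rw [h k hk]

lemma box_eq_of_mem {n N : ℕ} {w : Fin N → Fin n} {i : Fin n} {c x : Pt N}
    (h : x ∈ slice w i c) (μ ν : Fin N → ℝ) : box w i x μ ν = box w i c μ ν := by
  ext y
  exact and_congr_left' (forall₂_congr fun k hk => by rw [h k hk])

/-- A polytope is a parapolytope if its slices through its own points are boxes. -/
lemma isParapolytope_of_box {n N : ℕ} {w : Fin N → Fin n} (hw : Function.Surjective w)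
    {P : Set (Pt N)} (hP : IsConvexPolytope P) (μ ν : Pt N → Pt N)
    (hbox : ∀ i, ∀ c ∈ P, P ∩ slice w i c = box w i c (μ c) (ν c)) : IsParapolytope w P := by
  refine ⟨hP, fun i c => ?_⟩
  obtain hempty | ⟨x, hxP, hx⟩ := (P ∩ slice w i c).eq_empty_or_nonempty
  · refine ⟨1, 0, hempty.trans (Set.eq_empty_of_forall_notMem fun y hy => ?_).symm⟩
    obtain ⟨k, hk⟩ := hw i
    have := hy.2 k hk
    simp only [Pi.one_apply, Pi.zero_apply, Set.mem_Icc] at this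
    linarith [this.1, this.2]
  · exact ⟨μ x, ν x, by rw [← slice_eq_of_mem hx, hbox i x hxP, box_eq_of_mem hx]⟩

lemma box_ends_unique {n N : ℕ} {w : Fin N → Fin n} {i : Fin n} {c : Pt N} {μ ν μ' ν' : Pt N}
    (hne : (box w i c μ ν).Nonempty) (h : box w i c μ ν = box w i c μ' ν') {k : Fin N}
    (hk : w k = i) : μ k = μ' k ∧ ν k = ν' k := by
  have key : ∀ {a b a' b' : Pt N}, (box w i c a b).Nonempty → box w i c a b = box w i c a' b' →
      a' k ≤ a k ∧ b k ≤ b' k := by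
    rintro a b a' b' ⟨z, hz⟩ hab
    have hzk := hz.2 k hk
    have hupd : ∀ t ∈ Set.Icc (a k) (b k), t ∈ Set.Icc (a' k) (b' k) := by
      intro t ht
      have hmem : Function.update z k t ∈ box w i c a b := by
        refine ⟨fun l hl => ?_, fun l hl => ?_⟩
        · have : l ≠ k := fun h => hl (h ▸ hk)
          rw [Function.update_of_ne this]; exact hz.1 l hl
        · by_cases hlk : l = k
          · subst hlk; simpa using ht
          · rw [Function.update_of_ne hlk]; exact hz.2 l hl
      have := (hab ▸ hmem).2 k hk
      rwa [Function.update_self] at this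
    have hle := hzk.1.trans hzk.2
    exact ⟨(hupd _ ⟨le_rfl, hle⟩).1, (hupd _ ⟨hle, le_rfl⟩).2⟩
  have h₁ := key hne h
  have h₂ := key (h ▸ hne) h.symm
  exact ⟨le_antisymm h₂.1 h₁.1, le_antisymm h₁.2 h₂.2⟩

lemma demazureValue_of_box {n N : ℕ} (C : Fin n → Fin n → ℤ) {w : Fin N → Fin n} {k : Fin N}
    {P : Set (Pt N)} {x : Pt N} {μ ν : Pt N} (hne : (P ∩ slice w (w k) x).Nonempty)
    (hbox : P ∩ slice w (w k) x = box w (w k) x μ ν)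
    (hle : ∑ l ∈ Finset.univ.filter (fun l => w l = w k), (μ l + ν l) ≤ lfun C w (w k) x) :
    demazureValue C w k P x =
      if x ∈ box w (w k) x μ (Function.update ν k (ν k + lfun C w (w k) x
        - ∑ l ∈ Finset.univ.filter (fun l => w l = w k), (μ l + ν l))) then 1 else 0 := by
  have hex : ∃ μ ν : Fin N → ℝ,
      (P ∩ slice w (w k) x).Nonempty ∧ P ∩ slice w (w k) x = box w (w k) x μ ν :=
    ⟨μ, ν, hne, hbox⟩
  have hends : ∀ {l}, w l = w k → hex.choose l = μ l ∧ hex.choose_spec.choose l = ν l :=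
    fun hl => box_ends_unique (hex.choose_spec.choose_spec.2 ▸ hne)
      (hex.choose_spec.choose_spec.2.symm.trans hbox) hl
  have hsum : ∑ l ∈ Finset.univ.filter (fun l => w l = w k),
      (hex.choose l + hex.choose_spec.choose l) =
        ∑ l ∈ Finset.univ.filter (fun l => w l = w k), (μ l + ν l) :=
    Finset.sum_congr rfl fun l hl => by
      rw [(hends (Finset.mem_filter.1 hl).2).1, (hends (Finset.mem_filter.1 hl).2).2]
  simp only [demazureValue, dif_pos hex, hsum, (hends rfl).2]
  rw [if_pos (by linarith)]
  refine if_congr (and_congr_right' (forall₂_congr fun l hl => ?_)) rfl rfl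
  by_cases hlk : l = k
  · subst hlk; simp only [Function.update_self, (hends hl).1]
  · simp only [Function.update_of_ne hlk, (hends hl).1, (hends hl).2]

lemma demazureValue_of_empty {n N : ℕ} (C : Fin n → Fin n → ℤ) {w : Fin N → Fin n} {k : Fin N}
    {P : Set (Pt N)} {x : Pt N} (h : ¬ (P ∩ slice w (w k) x).Nonempty) :
    demazureValue C w k P x = 0 :=
  dif_neg fun ⟨_, _, hne, _⟩ => h hne

lemma lfun_eq_of_mem {n N : ℕ} (C : Fin n → Fin n → ℤ) {w : Fin N → Fin n} {i : Fin n}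
    {c x : Pt N} (h : x ∈ slice w i c) : lfun C w i x = lfun C w i c := by
  unfold lfun
  congr 1
  exact Finset.sum_congr rfl fun k hk => by rw [h k (Finset.mem_filter.1 hk).2]

/-- One step of a Demazure chain, in terms of the boxes cut out by the slices of `Q`. -/
lemma DemazureChain.step {n N : ℕ} {C : Fin n → Fin n → ℤ} {w : Fin N → Fin n} {l : ℕ}
    (hl : l < N) {P Q R : Set (Pt N)} (hQ : DemazureChain C w l P Q) (hpara : IsParapolytope w Q)
    (hR : IsConvexPolytope R) (p : ℝ) (hp : ∀ x ∈ Q, x ⟨l, hl⟩ = p) (μ ν : Pt N → Pt N)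
    (hbox : ∀ c ∈ Q, Q ∩ slice w (w ⟨l, hl⟩) c = box w (w ⟨l, hl⟩) c (μ c) (ν c))
    (hle : ∀ c ∈ Q, ∑ m ∈ Finset.univ.filter (fun m => w m = w ⟨l, hl⟩), (μ c m + ν c m) ≤
      lfun C w (w ⟨l, hl⟩) c)
    (hmem : ∀ x, x ∈ R ↔ ∃ c ∈ Q, ∃ t ∈ Set.Icc p (p + lfun C w (w ⟨l, hl⟩) c -
      ∑ m ∈ Finset.univ.filter (fun m => w m = w ⟨l, hl⟩), (μ c m + ν c m)),
        x = Function.update c ⟨l, hl⟩ t) :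
    DemazureChain C w (l + 1) P R := by
  refine .succ l hl P Q R hQ hpara (fun x hx y hy => (hp x hx).trans (hp y hy).symm) hR
    fun x => ?_
  set k : Fin N := ⟨l, hl⟩
  have hupd : ∀ (c : Pt N) (t : ℝ), c ∈ slice w (w k) (Function.update c k t) := by
    intro c t m hm
    rw [Function.update_of_ne fun h => hm (congrArg w h)]
  by_cases hne : (Q ∩ slice w (w k) x).Nonempty
  · obtain ⟨c, hc, hcx⟩ := hne
    have hends : ∀ d ∈ Q, μ d k = p ∧ ν d k = p := by
      intro d hd
      have hself : d ∈ box w (w k) d (μ d) (ν d) := hbox d hd ▸ ⟨hd, fun _ _ => rfl⟩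
      have hpin : ∀ t ∈ Set.Icc (μ d k) (ν d k), t = p := by
        intro t ht
        have : Function.update d k t ∈ box w (w k) d (μ d) (ν d) := by
          refine ⟨fun m hm => (hupd d t m hm).symm, fun m hm => ?_⟩
          by_cases hmk : m = k
          · subst hmk; simpa using ht
          · rw [Function.update_of_ne hmk]; exact hself.2 m hm
        have := hp _ (hbox d hd ▸ this : _ ∈ Q ∩ slice w (w k) d).1
        rwa [Function.update_self] at this
      have hd' := (hself.2 k rfl).1.trans (hself.2 k rfl).2
      exact ⟨hpin _ ⟨le_rfl, hd'⟩, hpin _ ⟨hd', le_rfl⟩⟩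
    have hxbox : Q ∩ slice w (w k) x = box w (w k) x (μ c) (ν c) := by
      rw [← slice_eq_of_mem hcx, hbox c hc, box_eq_of_mem hcx]
    rw [demazureValue_of_box C ⟨c, hc, hcx⟩ hxbox (by rw [← lfun_eq_of_mem C hcx]; exact hle c hc)]
    refine if_congr ?_ rfl rfl
    rw [hmem]
    constructor
    · intro hx
      have hxk := hx.2 k rfl
      rw [Function.update_self, (hends c hc).1, (hends c hc).2] at hxk
      have hd : Function.update x k p ∈ Q ∩ slice w (w k) x := by
        rw [hxbox]
        refine ⟨fun m hm => (hupd x p m hm).symm, fun m hm => ?_⟩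
        by_cases hmk : m = k
        · subst hmk; simp [hends c hc]
        · have := hx.2 m hm
          rw [Function.update_of_ne hmk] at this
          rwa [Function.update_of_ne hmk]
      have hsum : ∑ m ∈ Finset.univ.filter (fun m => w m = w k),
          (μ (Function.update x k p) m + ν (Function.update x k p) m) =
          ∑ m ∈ Finset.univ.filter (fun m => w m = w k), (μ c m + ν c m) := by
        refine Finset.sum_congr rfl fun m hm => ?_
        have heq : box w (w k) x (μ (Function.update x k p)) (ν (Function.update x k p)) =
            box w (w k) x (μ c) (ν c) := by
          rw [← box_eq_of_mem hd.2, ← hbox _ hd.1, slice_eq_of_mem hd.2, hxbox]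
        have := box_ends_unique (heq ▸ hxbox ▸ ⟨c, hc, hcx⟩) heq (Finset.mem_filter.1 hm).2
        rw [this.1, this.2]
      refine ⟨_, hd.1, x k, ?_, by simp⟩
      rwa [hsum, lfun_eq_of_mem C hd.2]
    · rintro ⟨d, hd, t, ht, rfl⟩
      have hdbox : box w (w k) d (μ d) (ν d) = box w (w k) d (μ c) (ν c) := by
        rw [← hbox d hd, slice_eq_of_mem (hupd d t), hxbox, box_eq_of_mem (hupd d t)]
      have hself : d ∈ box w (w k) d (μ d) (ν d) := hbox d hd ▸ ⟨hd, fun _ _ => rfl⟩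
      have hsum : ∑ m ∈ Finset.univ.filter (fun m => w m = w k), (μ d m + ν d m) =
          ∑ m ∈ Finset.univ.filter (fun m => w m = w k), (μ c m + ν c m) := by
        refine Finset.sum_congr rfl fun m hm => ?_
        have := box_ends_unique ⟨d, hself⟩ hdbox (Finset.mem_filter.1 hm).2
        rw [this.1, this.2]
      refine ⟨fun _ _ => rfl, fun m hm => ?_⟩
      by_cases hmk : m = k
      · subst hmk
        rw [Function.update_self, Function.update_self, (hends c hc).1, (hends c hc).2,
          ← lfun_eq_of_mem C (hupd d t), ← hsum]
        exact ht
      · rw [Function.update_of_ne hmk, Function.update_of_ne hmk]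
        exact (hdbox ▸ hself).2 m hm
  · rw [demazureValue_of_empty C hne, if_neg]
    rw [hmem]
    rintro ⟨c, hc, t, -, rfl⟩
    exact hne ⟨c, hc, hupd c t⟩

lemma DemazureChain.unique {n N : ℕ} {C : Fin n → Fin n → ℤ} {w : Fin N → Fin n} {l : ℕ}
    {P Q Q' : Set (Pt N)} (h : DemazureChain C w l P Q) (h' : DemazureChain C w l P Q') :
    Q = Q' := by
  induction h generalizing Q' with
  | zero => cases h'; rfl
  | succ l hl P Q R _ _ _ _ hval ih =>
    cases h' with
    | succ _ _ _ S _ hS _ _ _ hval' =>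
      obtain rfl := ih hS
      ext x
      have := (hval x).symm.trans (hval' x)
      by_cases hx : x ∈ R <;> by_cases hx' : x ∈ Q' <;> simp_all

lemma exists_update_iff {N : ℕ} {Q : Set (Pt N)} {k : Fin N} {p : ℝ} (hp : ∀ x ∈ Q, x k = p)
    (f g : Pt N → ℝ) (x : Pt N) :
    (∃ c ∈ Q, ∃ t ∈ Set.Icc (f c) (g c), x = Function.update c k t) ↔
      Function.update x k p ∈ Q ∧
        x k ∈ Set.Icc (f (Function.update x k p)) (g (Function.update x k p)) := by
  constructor
  · rintro ⟨c, hc, t, ht, rfl⟩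
    have : Function.update (Function.update c k t) k p = c := by
      rw [Function.update_idem, ← hp c hc, Function.update_eq_self]
    rw [this, Function.update_self]
    exact ⟨hc, ht⟩
  · rintro ⟨hc, ht⟩
    exact ⟨_, hc, x k, ht, by rw [Function.update_idem, Function.update_eq_self]⟩

/-! ### The iterates of the Demazure operators on `aLow` -/

lemma wordA3_surjective : Function.Surjective wordA3 := by decide

lemma forall_wordA3_eq_zero {p : Fin 6 → Prop} : (∀ k, wordA3 k = 0 → p k) ↔ p 1 ∧ p 5 := by
  simp [Fin.forall_fin_succ, wordA3]

lemma forall_wordA3_eq_one {p : Fin 6 → Prop} :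
    (∀ k, wordA3 k = 1 → p k) ↔ p 0 ∧ p 2 ∧ p 4 := by
  simp [Fin.forall_fin_succ, wordA3]

lemma forall_wordA3_eq_two {p : Fin 6 → Prop} : (∀ k, wordA3 k = 2 → p k) ↔ p 3 := by
  simp [Fin.forall_fin_succ, wordA3]

lemma forall_wordA3_ne_zero {p : Fin 6 → Prop} :
    (∀ k, wordA3 k ≠ 0 → p k) ↔ p 0 ∧ p 2 ∧ p 3 ∧ p 4 := by
  simp [Fin.forall_fin_succ, wordA3]

lemma forall_wordA3_ne_one {p : Fin 6 → Prop} :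
    (∀ k, wordA3 k ≠ 1 → p k) ↔ p 1 ∧ p 3 ∧ p 5 := by
  simp [Fin.forall_fin_succ, wordA3]

lemma forall_wordA3_ne_two {p : Fin 6 → Prop} :
    (∀ k, wordA3 k ≠ 2 → p k) ↔ p 0 ∧ p 1 ∧ p 2 ∧ p 4 ∧ p 5 := by
  simp [Fin.forall_fin_succ, wordA3]

lemma sum_wordA3_eq_zero (f : Fin 6 → ℝ) :
    ∑ m ∈ Finset.univ.filter (fun m => wordA3 m = 0), f m = f 1 + f 5 := by
  rw [Finset.sum_filter, Fin.sum_univ_six]; simp [wordA3]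

lemma sum_wordA3_eq_one (f : Fin 6 → ℝ) :
    ∑ m ∈ Finset.univ.filter (fun m => wordA3 m = 1), f m = f 0 + f 2 + f 4 := by
  rw [Finset.sum_filter, Fin.sum_univ_six]; simp [wordA3]

lemma sum_wordA3_eq_two (f : Fin 6 → ℝ) :
    ∑ m ∈ Finset.univ.filter (fun m => wordA3 m = 2), f m = f 3 := by
  rw [Finset.sum_filter, Fin.sum_univ_six]; simp [wordA3]

lemma lfun_cartanA3_zero (x : Pt 6) : lfun cartanA3 wordA3 0 x = x 0 + x 2 + x 4 := by
  rw [lfun, Finset.sum_filter, Fin.sum_univ_six]; simp [wordA3, cartanA3]; ring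

lemma lfun_cartanA3_two (x : Pt 6) : lfun cartanA3 wordA3 2 x = x 0 + x 2 + x 4 := by
  rw [lfun, Finset.sum_filter, Fin.sum_univ_six]; simp [wordA3, cartanA3]; ring

lemma lfun_cartanA3_one (x : Pt 6) : lfun cartanA3 wordA3 1 x = x 1 + x 5 + x 3 := by
  rw [lfun, Finset.sum_filter, Fin.sum_univ_six]; simp [wordA3, cartanA3]; ring

/-- The segment `D_2^{(1)}(aLow)`. -/
def iterOne : Set (Pt 6) :=
  {y | (-(1/3) ≤ y 0 ∧ y 0 ≤ 2/3) ∧ y 1 = -(5/4) ∧ y 2 = -(1/3) ∧ y 3 = -(3/2) ∧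
    y 4 = -(4/3) ∧ y 5 = -(1/4)}

/-- The trapezoid `D_1^{(2)} D_2^{(1)}(aLow)`. -/
def iterTwo : Set (Pt 6) :=
  {y | (-(1/3) ≤ y 0 ∧ y 0 ≤ 2/3) ∧ (-(5/4) ≤ y 1 ∧ y 1 ≤ y 0 + 1/12) ∧ y 2 = -(1/3) ∧
    y 3 = -(3/2) ∧ y 4 = -(4/3) ∧ y 5 = -(1/4)}

/-- The polytope `D_2^{(3)} D_1^{(2)} D_2^{(1)}(aLow)`. -/
def iterThree : Set (Pt 6) :=
  {y | (-(1/3) ≤ y 0 ∧ y 0 ≤ 2/3) ∧ (y 2 - 11/12 ≤ y 1 ∧ y 1 ≤ y 0 + 1/12) ∧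
    (-(1/3) ≤ y 2 ∧ y 2 ≤ 2/3) ∧ y 3 = -(3/2) ∧ y 4 = -(4/3) ∧ y 5 = -(1/4)}

/-- The polytope `D_3^{(4)} D_2^{(3)} D_1^{(2)} D_2^{(1)}(aLow)`. -/
def iterFour : Set (Pt 6) :=
  {y | (-(1/3) ≤ y 0 ∧ y 0 ≤ 2/3) ∧ (y 2 - 11/12 ≤ y 1 ∧ y 1 ≤ y 0 + 1/12) ∧
    (-(1/3) ≤ y 2 ∧ y 2 ≤ 2/3) ∧ (-(3/2) ≤ y 3 ∧ y 3 ≤ y 0 + y 2 + 1/6) ∧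
    y 4 = -(4/3) ∧ y 5 = -(1/4)}

/-- The lower ends of the boxes cut out by the slices of the first three iterates. -/
def lowerEnd (c : Pt 6) : Pt 6 :=
  ![max (-(1/3)) (c 1 - 1/12), c 2 - 11/12, -(1/3), -(3/2), -(4/3), -(1/4)]

lemma singleton_box (i : Fin 3) (c : Pt 6) (hc : c ∈ ({aLow} : Set (Pt 6))) :
    {aLow} ∩ slice wordA3 i c = box wordA3 i c aLow aLow := by
  obtain rfl : c = aLow := hc
  ext y
  simp only [Set.mem_inter_iff, Set.mem_singleton_iff, slice, box, Set.mem_ofPred_eq, Set.Icc_self]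
  constructor
  · rintro ⟨rfl, h⟩
    exact ⟨h, fun _ _ => rfl⟩
  · rintro ⟨h, h'⟩
    exact ⟨funext fun k => (em (wordA3 k = i)).elim (h' k) (h k), h⟩

lemma iterOne_box (i : Fin 3) (c : Pt 6) (hc : c ∈ iterOne) :
    iterOne ∩ slice wordA3 i c =
      box wordA3 i c aLow ![2/3, -(5/4), -(1/3), -(3/2), -(4/3), -(1/4)] := by
  ext y
  fin_cases i
  all_goals
    simp [iterOne, slice, box, forall_wordA3_eq_zero, forall_wordA3_eq_one,
      forall_wordA3_eq_two, forall_wordA3_ne_zero, forall_wordA3_ne_one,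
      forall_wordA3_ne_two, aLow] at hc ⊢
    grind

lemma iterTwo_box (i : Fin 3) (c : Pt 6) (hc : c ∈ iterTwo) :
    iterTwo ∩ slice wordA3 i c =
      box wordA3 i c (lowerEnd c) ![2/3, c 0 + 1/12, -(1/3), -(3/2), -(4/3), -(1/4)] := by
  ext y
  fin_cases i
  all_goals
    simp [iterTwo, slice, box, forall_wordA3_eq_zero, forall_wordA3_eq_one,
      forall_wordA3_eq_two, forall_wordA3_ne_zero, forall_wordA3_ne_one,
      forall_wordA3_ne_two, lowerEnd] at hc ⊢
    grind

lemma iterThree_box (i : Fin 3) (c : Pt 6) (hc : c ∈ iterThree) :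
    iterThree ∩ slice wordA3 i c =
      box wordA3 i c (lowerEnd c)
        ![2/3, c 0 + 1/12, min (c 1 + 11/12) (2/3), -(3/2), -(4/3), -(1/4)] := by
  ext y
  fin_cases i
  all_goals
    simp [iterThree, slice, box, forall_wordA3_eq_zero, forall_wordA3_eq_one,
      forall_wordA3_eq_two, forall_wordA3_ne_zero, forall_wordA3_ne_one,
      forall_wordA3_ne_two, lowerEnd] at hc ⊢
    grind

lemma isConvexPolytope_singleton {N : ℕ} (a : Pt N) : IsConvexPolytope {a} :=
  ⟨{a}, by simp⟩

/-- The `k`-th coordinate as an affine map. -/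
def coord (k : Fin 6) : Pt 6 →ᵃ[ℝ] ℝ :=
  (LinearMap.proj (R := ℝ) (φ := fun _ : Fin 6 => ℝ) k).toAffineMap

lemma coord_apply (k : Fin 6) (x : Pt 6) : coord k x = x k := rfl

/-- A set fibred over a polytope in the direction of one coordinate is a polytope. -/
lemma IsConvexPolytope.of_mem_iff {N : ℕ} {P R : Set (Pt N)} (hP : IsConvexPolytope P)
    {k : Fin N} {p : ℝ} (hp : ∀ x ∈ P, x k = p) (f g : Pt N →ᵃ[ℝ] ℝ)
    (hfg : ∀ x ∈ P, f x ≤ g x)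
    (h : ∀ x, x ∈ R ↔ Function.update x k p ∈ P ∧
      x k ∈ Set.Icc (f (Function.update x k p)) (g (Function.update x k p))) :
    IsConvexPolytope R := by
  convert hP.update_Icc k f g hfg using 1
  ext x
  exact (h x).trans (exists_update_iff hp f g x).symm

lemma mem_iterOne_iff (x : Pt 6) :
    x ∈ iterOne ↔ Function.update x 0 (-(1/3)) ∈ ({aLow} : Set (Pt 6)) ∧
      x 0 ∈ Set.Icc (-(1/3)) (2/3) := by
  simp [iterOne, aLow, funext_iff, Fin.forall_fin_succ]
  grind

lemma isConvexPolytope_iterOne : IsConvexPolytope iterOne := by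
  refine (isConvexPolytope_singleton aLow).of_mem_iff (k := 0) (p := -(1/3)) ?_
    (.const ℝ _ (-(1/3))) (.const ℝ _ (2/3)) ?_ mem_iterOne_iff
  · rintro _ rfl; simp [aLow]
  · intro x _; simp; norm_num

lemma isConvexPolytope_iterTwo : IsConvexPolytope iterTwo := by
  refine isConvexPolytope_iterOne.of_mem_iff (k := 1) (p := -(5/4)) (fun x hx => hx.2.1)
    (.const ℝ _ (-(5/4))) (coord 0 + .const ℝ _ (1/12)) (fun x hx => ?_) fun x => ?_
  · simp [iterOne, coord_apply] at hx ⊢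
    linarith
  · simp [iterOne, iterTwo, coord_apply]
    grind

/-- The projection of `iterThree` along the second coordinate is a rectangle. -/
lemma isConvexPolytope_rectangle : IsConvexPolytope
    {y : Pt 6 | (-(1/3) ≤ y 0 ∧ y 0 ≤ 2/3) ∧ y 1 = -(5/4) ∧ (-(1/3) ≤ y 2 ∧ y 2 ≤ 2/3) ∧
      y 3 = -(3/2) ∧ y 4 = -(4/3) ∧ y 5 = -(1/4)} := by
  refine isConvexPolytope_iterOne.of_mem_iff (k := 2) (p := -(1/3)) (fun x hx => hx.2.2.1)
    (.const ℝ _ (-(1/3))) (.const ℝ _ (2/3)) (fun x hx => ?_) fun x => ?_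
  · simp; norm_num
  · simp [iterOne]
    grind

lemma isConvexPolytope_iterThree : IsConvexPolytope iterThree := by
  refine isConvexPolytope_rectangle.of_mem_iff (k := 1) (p := -(5/4)) (fun x hx => hx.2.1)
    (coord 2 + .const ℝ _ (-(11/12))) (coord 0 + .const ℝ _ (1/12)) (fun x hx => ?_) fun x => ?_
  · simp [coord_apply] at hx ⊢
    linarith
  · simp [iterThree, coord_apply]
    grind

lemma isConvexPolytope_iterFour : IsConvexPolytope iterFour := by
  refine isConvexPolytope_iterThree.of_mem_iff (k := 3) (p := -(3/2))
    (fun x hx => hx.2.2.2.1) (.const ℝ _ (-(3/2))) (coord 0 + coord 2 + .const ℝ _ (1/6))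
    (fun x hx => ?_) fun x => ?_
  · simp [iterThree, coord_apply] at hx ⊢
    linarith
  · simp [iterThree, iterFour, coord_apply]
    grind

lemma isParapolytope_singleton : IsParapolytope wordA3 {aLow} :=
  isParapolytope_of_box wordA3_surjective (isConvexPolytope_singleton aLow) _ _ singleton_box

lemma isParapolytope_iterOne : IsParapolytope wordA3 iterOne :=
  isParapolytope_of_box wordA3_surjective isConvexPolytope_iterOne _ _ iterOne_box

lemma isParapolytope_iterTwo : IsParapolytope wordA3 iterTwo :=
  isParapolytope_of_box wordA3_surjective isConvexPolytope_iterTwo _ _ iterTwo_box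

lemma isParapolytope_iterThree : IsParapolytope wordA3 iterThree :=
  isParapolytope_of_box wordA3_surjective isConvexPolytope_iterThree _ _ iterThree_box

lemma demazureChain_iterOne : DemazureChain cartanA3 wordA3 1 {aLow} iterOne := by
  have hp : ∀ x ∈ ({aLow} : Set (Pt 6)), x 0 = -(1/3) := by rintro _ rfl; rfl
  have hl : 0 < 6 := by norm_num
  refine DemazureChain.step hl (.zero _) isParapolytope_singleton
    isConvexPolytope_iterOne (-(1/3)) hp _ _ (singleton_box 1) ?_ fun x => ?_
  · intro c hc
    obtain rfl : c = aLow := hc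
    erw [sum_wordA3_eq_one, lfun_cartanA3_one]
    simp [aLow]
    norm_num
  · erw [exists_update_iff hp (fun _ => -(1/3)), mem_iterOne_iff]
    refine and_congr_right fun hx => ?_
    erw [sum_wordA3_eq_one, lfun_cartanA3_one]
    erw [Set.mem_singleton_iff.1 hx]
    simp [aLow]
    norm_num

lemma demazureChain_iterTwo : DemazureChain cartanA3 wordA3 2 {aLow} iterTwo := by
  have hp : ∀ x ∈ iterOne, x 1 = -(5/4) := fun x hx => hx.2.1
  have hl : 1 < 6 := by norm_num
  refine DemazureChain.step hl demazureChain_iterOne isParapolytope_iterOne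
    isConvexPolytope_iterTwo (-(5/4)) hp _ _ (iterOne_box 0) ?_ fun x => ?_
  · intro c hc
    erw [sum_wordA3_eq_zero, lfun_cartanA3_zero]
    simp [iterOne, aLow] at hc ⊢
    linarith
  · erw [exists_update_iff hp (fun _ => -(5/4)), sum_wordA3_eq_zero, lfun_cartanA3_zero]
    simp [iterOne, iterTwo, aLow]
    grind

lemma demazureChain_iterThree : DemazureChain cartanA3 wordA3 3 {aLow} iterThree := by
  have hp : ∀ x ∈ iterTwo, x 2 = -(1/3) := fun x hx => hx.2.2.1
  have hl : 2 < 6 := by norm_num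
  refine DemazureChain.step hl demazureChain_iterTwo isParapolytope_iterTwo
    isConvexPolytope_iterThree (-(1/3)) hp _ _ (iterTwo_box 1) ?_ fun x => ?_
  · intro c hc
    erw [sum_wordA3_eq_one, lfun_cartanA3_one]
    simp [iterTwo, lowerEnd] at hc ⊢
    grind
  · erw [exists_update_iff hp (fun _ => -(1/3)), sum_wordA3_eq_one, lfun_cartanA3_one]
    simp [iterTwo, iterThree, lowerEnd]
    grind

lemma demazureChain_iterFour : DemazureChain cartanA3 wordA3 4 {aLow} iterFour := by
  have hp : ∀ x ∈ iterThree, x 3 = -(3/2) := fun x hx => hx.2.2.2.1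
  have hl : 3 < 6 := by norm_num
  refine DemazureChain.step hl demazureChain_iterThree isParapolytope_iterThree
    isConvexPolytope_iterFour (-(3/2)) hp _ _ (iterThree_box 2) ?_ fun x => ?_
  · intro c hc
    erw [sum_wordA3_eq_two, lfun_cartanA3_two]
    simp [iterThree, lowerEnd] at hc ⊢
    linarith
  · erw [exists_update_iff hp (fun _ => -(3/2)), sum_wordA3_eq_two, lfun_cartanA3_two]
    simp [iterThree, iterFour, lowerEnd]
    grind

lemma iterFour_inter_slice : iterFour ∩ slice wordA3 1 cLow =
    {y : Pt 6 | y 1 = -(1/4) ∧ y 3 = 1/2 ∧ y 5 = -(1/4) ∧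
      -(1/3) ≤ y 0 ∧ y 0 ≤ 2/3 ∧ -(y 0) + 1/3 ≤ y 2 ∧ y 2 ≤ 2/3 ∧ y 4 = -(4/3)} := by
  ext y
  simp only [iterFour, slice, forall_wordA3_ne_one, Set.mem_inter_iff, Set.mem_ofPred_eq]
  have h₁ : cLow 1 = -(1/4) := rfl
  have h₃ : cLow 3 = 1/2 := rfl
  have h₅ : cLow 5 = -(1/4) := rfl
  rw [h₁, h₃, h₅]
  constructor
  · rintro ⟨⟨⟨_, _⟩, ⟨_, _⟩, ⟨_, _⟩, ⟨_, _⟩, _, _⟩, _, _, _⟩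
    refine ⟨?_, ?_, ?_, ?_, ?_, ?_, ?_, ?_⟩ <;> linarith
  · rintro ⟨_, _, _, _, _, _, _, _⟩
    refine ⟨⟨⟨?_, ?_⟩, ⟨?_, ?_⟩, ⟨?_, ?_⟩, ⟨?_, ?_⟩, ?_, ?_⟩, ?_, ?_, ?_⟩ <;> linarith

lemma not_isParapolytope_iterFour : ¬ IsParapolytope wordA3 iterFour := by
  rintro ⟨-, h⟩
  obtain ⟨μ, ν, h⟩ := h 1 cLow
  rw [iterFour_inter_slice] at h
  have key : ∀ s t : ℝ, -(1/3) ≤ s ∧ s ≤ 2/3 ∧ -s + 1/3 ≤ t ∧ t ≤ 2/3 ↔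
      (![s, -(1/4), t, 1/2, -(4/3), -(1/4)] : Pt 6) ∈ box wordA3 1 cLow μ ν := by
    intro s t
    rw [← h]
    simp
  simp [box, forall_wordA3_ne_one, forall_wordA3_eq_one, cLow] at key
  have h₁ := (key (-(1/3)) (2/3)).1 (by norm_num)
  have h₂ := (key (2/3) (-(1/3))).1 (by norm_num)
  have h₃ := (key (-(1/3)) (-(1/3))).2 ⟨h₁.1, h₂.2.1, h₁.2.2⟩
  norm_num at h₃

/-- Example 2.4.  For `G = SL₄(ℂ)` and the reduced word
`i = (2,1,2,3,2,1)` for `w₀`, the linear functions are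
`l_1(a) = l_3(a) = a_1^{(2)} + a_2^{(2)} + a_3^{(2)}` and
`l_2(a) = a_1^{(1)} + a_2^{(1)} + a_1^{(3)}`.  For the point `a_low` the iterates
`D_2^{(1)}(a_low)`, `D_1^{(2)}D_2^{(1)}(a_low)`, `D_2^{(3)}D_1^{(2)}D_2^{(1)}(a_low)`
are well-defined parapolytopes and `D_3^{(4)}D_2^{(3)}D_1^{(2)}D_2^{(1)}(a_low)` is a
well-defined convex polytope, but the latter is not a parapolytope: its slice at `c` is
the explicitly given set, which is not a coordinate box.  Consequently
`D_2^{(5)}D_3^{(4)}D_2^{(3)}D_1^{(2)}D_2^{(1)}(a_low)` is not well-defined. -/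
theorem statement19 :
    IsReducedWordForLongest cartanA3 (List.ofFn wordA3) ∧
    (∀ x : Pt 6, lfun cartanA3 wordA3 0 x = x 0 + x 2 + x 4) ∧
    (∀ x : Pt 6, lfun cartanA3 wordA3 2 x = x 0 + x 2 + x 4) ∧
    (∀ x : Pt 6, lfun cartanA3 wordA3 1 x = x 1 + x 5 + x 3) ∧
    (∃ Q₁ Q₂ Q₃ Q₄ : Set (Pt 6),
      DemazureChain cartanA3 wordA3 1 {aLow} Q₁ ∧ IsParapolytope wordA3 Q₁ ∧
      DemazureChain cartanA3 wordA3 2 {aLow} Q₂ ∧ IsParapolytope wordA3 Q₂ ∧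
      DemazureChain cartanA3 wordA3 3 {aLow} Q₃ ∧ IsParapolytope wordA3 Q₃ ∧
      DemazureChain cartanA3 wordA3 4 {aLow} Q₄ ∧ IsConvexPolytope Q₄ ∧
      ¬ IsParapolytope wordA3 Q₄ ∧
      Q₄ ∩ slice wordA3 1 cLow =
        {y : Pt 6 | y 1 = -(1/4) ∧ y 3 = 1/2 ∧ y 5 = -(1/4) ∧
          -(1/3) ≤ y 0 ∧ y 0 ≤ 2/3 ∧ -(y 0) + 1/3 ≤ y 2 ∧ y 2 ≤ 2/3 ∧ y 4 = -(4/3)}) ∧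
    ¬ ∃ R : Set (Pt 6), DemazureChain cartanA3 wordA3 5 {aLow} R := by
  refine ⟨isReducedWordForLongest_wordA3, lfun_cartanA3_zero, lfun_cartanA3_two,
    lfun_cartanA3_one, ⟨iterOne, iterTwo, iterThree, iterFour, demazureChain_iterOne,
      isParapolytope_iterOne, demazureChain_iterTwo, isParapolytope_iterTwo,
      demazureChain_iterThree, isParapolytope_iterThree, demazureChain_iterFour,
      isConvexPolytope_iterFour, not_isParapolytope_iterFour, iterFour_inter_slice⟩, ?_⟩
  rintro ⟨R, hR⟩
  cases hR with
  | succ _ _ _ Q _ hQ hpara _ _ _ =>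
    exact not_isParapolytope_iterFour (hQ.unique demazureChain_iterFour ▸ hpara)

end NZ
end
end
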